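/- arXiv:1611.06116 — 3 statements merged into one kernel-verified Lean document; each statement's English description precedes it below -/
import Mathlib

section
/- Let k be a positive integer written uniquely as k = 2^a(8t+α) with a,t nonnegative integers and α ∈ {1,3,5,7}. Then the number of (x,y,z) ∈ ℤ³ with x²+y²+16z² = k equals: (1/3)𝔯₁(k) + δ_□(k)·(−1)^((√k−1)/2)·2√k if (a,α) = (0,1); (1/3)𝔯₁(k) if (a,α) ∈ {(0,5),(1,1),(1,5)} or a = 3 (with any α); (2/3)𝔯₁(k) if (a,α) ∈ {(2,1),(2,5)}; 𝔯₁(k) if a ≥ 4; and 0 in all remaining cases (namely (a,α) ∈ {(0,3),(0,7),(1,3),(1,7),(2,3),(2,7)}). -/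
/-- The number of representations of `k` as a sum of three squares. -/
noncomputable def r1 (k : ℕ) : ℕ :=
  Nat.card {v : ℤ × ℤ × ℤ // v.1 ^ 2 + v.2.1 ^ 2 + v.2.2 ^ 2 = (k : ℤ)}

/-- `δ_□(k) · (−1)^((√k−1)/2) · √k`, as a rational number. -/
noncomputable def sqTerm (k : ℕ) : ℚ :=
  if IsSquare k then (-1 : ℚ) ^ ((Nat.sqrt k - 1) / 2) * (Nat.sqrt k : ℚ) else 0

/-- `∏_{i=1}^m (1 - h^{2i})`. -/
def qPoch {R : Type*} [CommRing R] (h : R) (m : ℕ) : R :=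
  ∏ i ∈ Finset.range m, (1 - h ^ (2 * (i + 1)))

/-- The coefficient of `z^j` in `(1 + z⁻¹)^e ∏_{i=1}^n (1 + h^{2i-1+e} z) (1 + h^{2i-1+e} z⁻¹)`,
for `e = 0` or `e = 1`. -/
def tripleCoeff {R : Type*} [CommRing R] (h : R) (e : ℕ) : ℕ → ℤ → R
  | 0, j => if j = 0 ∨ j = -e then 1 else 0
  | n + 1, j => h ^ (2 * n + 1 + e) * (tripleCoeff h e n (j - 1) + tripleCoeff h e n (j + 1)) +
      (1 + (h ^ (2 * n + 1 + e)) ^ 2) * tripleCoeff h e n j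

section

variable {R : Type*} [CommRing R]

theorem qPoch_succ (h : R) (m : ℕ) :
    qPoch h (m + 1) = qPoch h m * (1 - h ^ (2 * (m + 1))) := by
  simp [qPoch, Finset.prod_range_succ]

theorem tripleCoeff_eq_zero (h : R) (e n : ℕ) (j : ℤ) (hj : (n : ℤ) < j ∨ j < -n - e) :
    tripleCoeff h e n j = 0 := by
  induction n generalizing j with
  | zero =>
    have : ¬ (j = 0 ∨ j = -(e : ℤ)) := by omega
    simp [tripleCoeff, this]
  | succ n ih =>
    rw [tripleCoeff, ih (j - 1) (by omega), ih (j + 1) (by omega), ih j (by omega)]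
    ring

theorem tripleCoeff_mul_qPoch (h : R) (e : ℕ) (he : e ≤ 1) (n s t : ℕ) (j : ℤ)
    (hst : s + t = 2 * n + e) (hj : j = n - s) :
    tripleCoeff h e n j * (qPoch h s * qPoch h t) =
      h ^ (j * (j + e)).toNat * qPoch h (2 * n + e) := by
  induction n generalizing s t j with
  | zero =>
    have h1 : j = 0 ∨ j = -(e : ℤ) := by omega
    have h2 : (j * (j + e)).toNat = 0 := by rcases h1 with rfl | rfl <;> simp
    rw [h2]
    simp only [tripleCoeff, h1, if_true]
    have : (s = 0 ∧ t = e) ∨ (s = e ∧ t = 0) := by omega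
    rcases this with ⟨rfl, rfl⟩ | ⟨rfl, rfl⟩ <;> simp [qPoch]
  | succ n ih =>
    have key : 0 ≤ j * (j + e) := by
      rcases le_or_gt 0 j with h0 | h0
      · positivity
      · nlinarith
    have key1 : 0 ≤ (j - 1) * (j - 1 + e) := by
      rcases le_or_gt 1 j with h0 | h0
      · nlinarith
      · nlinarith
    have key2 : 0 ≤ (j + 1) * (j + 1 + e) := by
      rcases le_or_gt (-1) j with h0 | h0
      · nlinarith
      · nlinarith
    have e1 : h ^ (2 * n + 1 + e) * h ^ ((j - 1) * (j - 1 + e)).toNat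
        = h ^ (j * (j + e)).toNat * h ^ (2 * s) := by
      rw [← pow_add, ← pow_add]
      congr 1
      zify
      rw [Int.toNat_of_nonneg key, Int.toNat_of_nonneg key1, hj]
      have : (t : ℤ) = 2 * (n + 1) + e - s := by omega
      push_cast
      ring
    have e2 : h ^ (2 * n + 1 + e) * h ^ ((j + 1) * (j + 1 + e)).toNat
        = h ^ (j * (j + e)).toNat * h ^ (2 * t) := by
      rw [← pow_add, ← pow_add]
      congr 1
      zify
      rw [Int.toNat_of_nonneg key, Int.toNat_of_nonneg key2, hj]
      have : (t : ℤ) = 2 * (n + 1) + e - s := by omega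
      rw [this]
      push_cast
      ring
    have eP : qPoch h (2 * (n + 1) + e) = qPoch h (2 * n + e) *
        ((1 - (h ^ (2 * n + 1 + e)) ^ 2) * (1 - h ^ (2 * s) * h ^ (2 * t))) := by
      rw [show 2 * (n + 1) + e = (2 * n + e + 1) + 1 by ring, qPoch_succ, qPoch_succ, ← pow_add,
        ← pow_mul, show 2 * s + 2 * t = 2 * (2 * n + e + 1 + 1) by omega, mul_assoc]
      congr 4
      ring
    rw [eP, tripleCoeff]
    generalize hU : h ^ (2 * n + 1 + e) = U at *
    have tA (s' t' : ℕ) (h1 : s = s') (h2 : t = t' + 2) :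
        U * tripleCoeff h e n (j - 1) * (qPoch h s' * qPoch h t') =
          h ^ (j * (j + e)).toNat * h ^ (2 * s) * qPoch h (2 * n + e) := by
      rw [mul_assoc, ih s' t' (j - 1) (by omega) (by omega), ← mul_assoc, e1]
    have tB (s' t' : ℕ) (h1 : s = s' + 1) (h2 : t = t' + 1) :=
      ih s' t' j (by omega) (by omega)
    have tC (s' t' : ℕ) (h1 : s = s' + 2) (h2 : t = t') :
        U * tripleCoeff h e n (j + 1) * (qPoch h s' * qPoch h t') =
          h ^ (j * (j + e)).toNat * h ^ (2 * t) * qPoch h (2 * n + e) := by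
      rw [mul_assoc, ih s' t' (j + 1) (by omega) (by omega), ← mul_assoc, e2]
    have z1 (hs : s < 2) : tripleCoeff h e n (j + 1) = 0 :=
      tripleCoeff_eq_zero _ _ _ _ (by omega)
    have z2 (hs : s < 1) : tripleCoeff h e n j = 0 :=
      tripleCoeff_eq_zero _ _ _ _ (by omega)
    have z3 (hs : t < 2) : tripleCoeff h e n (j - 1) = 0 :=
      tripleCoeff_eq_zero _ _ _ _ (by omega)
    have z4 (hs : t < 1) : tripleCoeff h e n j = 0 :=
      tripleCoeff_eq_zero _ _ _ _ (by omega)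
    have hU2 : U ^ 2 = h ^ (2 * (s + t - 1)) := by
      rw [← hU, ← pow_mul]
      congr 1
      omega
    have f1 (m : ℕ) : qPoch h (m + 2) =
        qPoch h m * (1 - h ^ (2 * (m + 1))) * (1 - h ^ (2 * (m + 2))) := by
      rw [qPoch_succ, qPoch_succ]
    generalize h ^ (j * (j + e)).toNat = E at *
    generalize qPoch h (2 * n + e) = Q at *
    rcases s with _ | _ | s
    · obtain ⟨t, rfl⟩ : ∃ t', t = t' + 2 := ⟨t - 2, by omega⟩
      have hA := tA 0 t rfl rfl
      rw [z1 (by omega), z2 (by omega), hU2, f1 t]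
      rw [show 0 + (t + 2) - 1 = t + 1 by omega]
      linear_combination (1 - h ^ (2 * (t + 1))) * (1 - h ^ (2 * (t + 2))) * hA
    · rcases t with _ | _ | t
      · omega
      · have hB := tB 0 0 rfl rfl
        rw [z1 (by omega), z3 (by omega), hU2, qPoch_succ]
        simp only [zero_add] at *
        linear_combination (1 + h ^ 2) * (1 - h ^ 2) * (1 - h ^ 2) * hB
      · have hA := tA 1 t rfl rfl
        have hB := tB 0 (t + 1) rfl rfl
        rw [z1 (by omega), hU2, f1 t]
        rw [show 0 + 1 + (t + 2) - 1 = t + 2 by omega]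
        rw [qPoch_succ h t] at hB
        rw [qPoch_succ h 0] at *
        linear_combination (1 - h ^ (2 * (t + 1))) * (1 - h ^ (2 * (t + 2))) * hA +
          (1 + h ^ (2 * (t + 2))) * (1 - h ^ 2) * (1 - h ^ (2 * (t + 2))) * hB
    · rcases t with _ | _ | t
      · have hC := tC s 0 rfl rfl
        rw [z3 (by omega), z4 (by omega), hU2, f1 s]
        rw [show s + 1 + 1 + 0 - 1 = s + 1 by omega]
        linear_combination (1 - h ^ (2 * (s + 1))) * (1 - h ^ (2 * (s + 2))) * hC
      · have hC := tC s 1 rfl rfl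
        have hB := tB (s + 1) 0 rfl rfl
        rw [z3 (by omega), hU2, f1 s]
        rw [show s + 1 + 1 + (0 + 1) - 1 = s + 2 by omega]
        rw [qPoch_succ h s] at hB
        rw [qPoch_succ h 0] at *
        linear_combination (1 - h ^ (2 * (s + 1))) * (1 - h ^ (2 * (s + 2))) * hC +
          (1 + h ^ (2 * (s + 2))) * (1 - h ^ 2) * (1 - h ^ (2 * (s + 2))) * hB
      · have hA := tA (s + 2) t rfl rfl
        have hB := tB (s + 1) (t + 1) rfl rfl
        have hC := tC s (t + 2) rfl rfl
        rw [hU2, f1 s, f1 t]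
        rw [f1 s] at hA
        rw [f1 t] at hC
        rw [qPoch_succ h s, qPoch_succ h t] at hB
        rw [show s + 1 + 1 + (t + 1 + 1) - 1 = s + t + 3 by omega]
        linear_combination (1 - h ^ (2 * (t + 1))) * (1 - h ^ (2 * (t + 2))) * hA +
          (1 - h ^ (2 * (s + 1))) * (1 - h ^ (2 * (s + 2))) * hC +
          (1 + h ^ (2 * (s + t + 3))) * (1 - h ^ (2 * (s + 2))) * (1 - h ^ (2 * (t + 2))) * hB

/-- Summing the coefficients against an eigensequence of the discrete Laplacian. -/
theorem finsum_mul_tripleCoeff_succ (h : R) (e n : ℕ) (c : ℤ → R) (κ : R)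
    (hc : ∀ j, c (j - 1) + c (j + 1) = κ * c j) :
    ∑ᶠ j, c j * tripleCoeff h e (n + 1) j =
      (1 + κ * h ^ (2 * n + 1 + e) + (h ^ (2 * n + 1 + e)) ^ 2) *
        ∑ᶠ j, c j * tripleCoeff h e n j := by
  have fin (f : ℤ → R) (a : ℤ) :
      (Function.support fun j => f j * tripleCoeff h e n (j + a)).Finite := by
    refine (Set.finite_Icc (-(n : ℤ) - e - a) (n - a)).subset fun j hj => ?_
    by_contra hcon
    apply hj
    rw [Set.mem_Icc] at hcon
    simp only
    rw [tripleCoeff_eq_zero _ _ _ _ (by omega), mul_zero]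
  have shift (a : ℤ) : ∑ᶠ j, c (j - a) * tripleCoeff h e n j =
      ∑ᶠ j, c j * tripleCoeff h e n (j + a) := by
    rw [← finsum_comp_equiv (Equiv.addRight a)]
    simp
  have fin0 (f : ℤ → R) : (Function.support fun j => f j * tripleCoeff h e n j).Finite := by
    simpa using fin f 0
  have finmul (r : R) {f : ℤ → R} (hf : (Function.support f).Finite) :
      (Function.support fun j => r * f j).Finite :=
    hf.subset fun j hj h0 => hj (by simp [h0])
  generalize hU : h ^ (2 * n + 1 + e) = U at *
  have split : ∑ᶠ j, c j * tripleCoeff h e (n + 1) j =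
      U * (∑ᶠ j, c j * tripleCoeff h e n (j + -1)) +
      U * (∑ᶠ j, c j * tripleCoeff h e n (j + 1)) +
      (1 + U ^ 2) * ∑ᶠ j, c j * tripleCoeff h e n j := by
    rw [mul_finsum' _ _ (fin c (-1)), mul_finsum' _ _ (fin c 1), mul_finsum' _ _ (fin0 c),
      ← finsum_add_distrib, ← finsum_add_distrib]
    · refine finsum_congr fun j => ?_
      rw [tripleCoeff, hU]
      simp only [← sub_eq_add_neg]
      ring
    · exact ((finmul U (fin c (-1))).union (finmul U (fin c 1))).subset
        (Function.support_add _ _)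
    · exact finmul _ (fin0 c)
    · exact finmul _ (fin c (-1))
    · exact finmul _ (fin c 1)
  rw [split, ← shift, ← shift, ← mul_add, ← finsum_add_distrib (fin0 _) (fin0 _)]
  have : ∀ j, c (j - -1) * tripleCoeff h e n j + c (j - 1) * tripleCoeff h e n j =
      κ * (c j * tripleCoeff h e n j) := by
    intro j
    rw [← mul_assoc, ← hc, sub_neg_eq_add]
    ring
  rw [finsum_congr this, ← mul_finsum' _ _ (fin0 c)]
  ring

end

section

open PowerSeries

theorem isUnit_qPoch {d : ℕ} (hd : d ≠ 0) (m : ℕ) : IsUnit (qPoch ((X : ℤ⟦X⟧) ^ d) m) := by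
  rw [PowerSeries.isUnit_iff_constantCoeff, qPoch, map_prod]
  simp [hd]

theorem qPoch_congr {R : Type*} [CommRing R] (h : R) {a b : ℕ} (hab : a ≤ b) :
    h ^ (2 * (a + 1)) ∣ qPoch h b - qPoch h a := by
  induction b, hab using Nat.le_induction with
  | base => simp
  | succ b hab ih =>
    rw [qPoch_succ]
    have : h ^ (2 * (a + 1)) ∣ h ^ (2 * (b + 1)) := pow_dvd_pow _ (by omega)
    have := dvd_sub ih (this.mul_left (qPoch h b))
    convert this using 1
    ring

theorem qPoch_mul_tripleCoeff_congr {d : ℕ} (hd : d ≠ 0) (e : ℕ) (he : e ≤ 1) (n : ℕ) (j : ℤ)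
    (hj : -(n : ℤ) - e ≤ j) (hj' : j ≤ n) :
    ((X : ℤ⟦X⟧) ^ d) ^ (2 * n + 1) ∣ qPoch (X ^ d) n * tripleCoeff (X ^ d) e n j -
      (X ^ d) ^ (j * (j + e)).toNat := by
  obtain ⟨s, hs⟩ : ∃ s : ℕ, (s : ℤ) = n - j := ⟨(n - j).toNat, by omega⟩
  obtain ⟨t, ht⟩ : ∃ t : ℕ, (t : ℤ) = n + j + e := ⟨(n + j + e).toNat, by omega⟩
  have key := tripleCoeff_mul_qPoch ((X : ℤ⟦X⟧) ^ d) e he n s t j (by omega) (by omega)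
  have hu : IsUnit (qPoch ((X : ℤ⟦X⟧) ^ d) s * qPoch (X ^ d) t) :=
    (isUnit_qPoch hd s).mul (isUnit_qPoch hd t)
  rw [← hu.dvd_mul_right]
  generalize (X : ℤ⟦X⟧) ^ d = h at *
  have reduce : (qPoch h n * tripleCoeff h e n j - h ^ (j * (j + e)).toNat) *
      (qPoch h s * qPoch h t) =
      h ^ (j * (j + e)).toNat * (qPoch h (2 * n + e) * qPoch h n - qPoch h s * qPoch h t) := by
    linear_combination qPoch h n * key
  rw [reduce]
  have bound (r : ℕ) (hr : r ≤ n) (hrs : r ≤ s) (hrt : r ≤ t)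
      (hE : 2 * (n : ℤ) ≤ j * (j + e) + 2 * r + 1) :
      h ^ (2 * n + 1) ∣ h ^ (j * (j + e)).toNat *
        (qPoch h (2 * n + e) * qPoch h n - qPoch h s * qPoch h t) := by
    have hle : 2 * n + 1 ≤ (j * (j + e)).toNat + 2 * (r + 1) := by
      have := Int.self_le_toNat (j * (j + e))
      omega
    refine (pow_dvd_pow h hle).trans ?_
    rw [pow_add]
    refine mul_dvd_mul_left _ ?_
    obtain ⟨a, ha⟩ := qPoch_congr h (show r ≤ 2 * n + e by omega)
    obtain ⟨b, hb⟩ := qPoch_congr h hr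
    obtain ⟨c, hc⟩ := qPoch_congr h hrs
    obtain ⟨f, hf⟩ := qPoch_congr h hrt
    refine ⟨a * qPoch h n + qPoch h r * b - c * qPoch h t - qPoch h r * f, ?_⟩
    linear_combination qPoch h n * ha + qPoch h r * hb - qPoch h t * hc - qPoch h r * hf
  rcases le_or_gt 0 j with h0 | h0
  · refine bound s (by omega) le_rfl (by omega) ?_
    rw [hs]
    have : (0 : ℤ) ≤ e := by positivity
    nlinarith [sq_nonneg (j - 1), mul_nonneg h0 this]
  · refine bound t (by omega) (by omega) le_rfl ?_
    rw [ht]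
    interval_cases e
    · push_cast
      nlinarith [sq_nonneg (j + 1)]
    · push_cast
      nlinarith [sq_nonneg (2 * j + 3)]

theorem qPoch_mul_finsum_congr {d : ℕ} (hd : d ≠ 0) (e : ℕ) (he : e ≤ 1) (n : ℕ)
    (c : ℤ → ℤ⟦X⟧) :
    ((X : ℤ⟦X⟧) ^ d) ^ (2 * n + 1) ∣
      qPoch (X ^ d) n * (∑ᶠ j, c j * tripleCoeff (X ^ d) e n j) -
        ∑ j ∈ Finset.Icc (-(n : ℤ) - e) n, c j * (X ^ d) ^ (j * (j + e)).toNat := by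
  rw [finsum_eq_sum_of_support_subset (s := Finset.Icc (-(n : ℤ) - e) n), Finset.mul_sum,
    ← Finset.sum_sub_distrib]
  · refine Finset.dvd_sum fun j hj => ?_
    rw [Finset.mem_Icc] at hj
    have := (qPoch_mul_tripleCoeff_congr hd e he n j hj.1 hj.2).mul_left (c j)
    convert this using 1
    ring
  · intro j hj
    by_contra hcon
    apply hj
    rw [Finset.coe_Icc, Set.mem_Icc] at hcon
    simp only
    rw [tripleCoeff_eq_zero _ _ _ _ (by omega), mul_zero]

/-- `1` on even integers and `-1` on odd integers. -/
def paritySign (j : ℤ) : ℤ := if Even j then 1 else -1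

theorem paritySign_add_one (j : ℤ) : paritySign (j + 1) = -paritySign j := by
  unfold paritySign
  by_cases h : Even j <;> simp [h, parity_simps]

theorem paritySign_sub_one (j : ℤ) : paritySign (j - 1) = -paritySign j := by
  have := paritySign_add_one (j - 1)
  rw [sub_add_cancel] at this
  omega

theorem finsum_one_mul_tripleCoeff {R : Type*} [CommRing R] (h : R) (n : ℕ) :
    ∑ᶠ j, (1 : R) * tripleCoeff h 1 n j =
      2 * (∏ i ∈ Finset.range n, (1 + h ^ (2 * (i + 1)))) ^ 2 := by
  induction n with
  | zero =>
    rw [finsum_eq_sum_of_support_subset (s := {0, -1})]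
    · rw [Finset.sum_pair (by norm_num)]
      simp [tripleCoeff]
      norm_num
    · intro j hj
      by_contra hcon
      apply hj
      have : ¬ (j = 0 ∨ j = -1) := by simpa using hcon
      simp [tripleCoeff, this]
  | succ n ih =>
    rw [finsum_mul_tripleCoeff_succ h 1 n (fun _ => 1) 2 (by intro; norm_num), ih,
      Finset.prod_range_succ]
    ring

theorem finsum_paritySign_mul_tripleCoeff {R : Type*} [CommRing R] (h : R) (n : ℕ) :
    ∑ᶠ j, (paritySign j : R) * tripleCoeff h 0 n j =
      (∏ i ∈ Finset.range n, (1 - h ^ (2 * i + 1))) ^ 2 := by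
  induction n with
  | zero =>
    rw [finsum_eq_sum_of_support_subset (s := {0})]
    · simp [tripleCoeff, paritySign]
    · intro j hj
      by_contra hcon
      apply hj
      have : ¬ (j = 0) := by simpa using hcon
      simp [tripleCoeff, this]
  | succ n ih =>
    rw [finsum_mul_tripleCoeff_succ h 0 n (fun j => (paritySign j : R)) (-2), ih,
      Finset.prod_range_succ]
    · ring
    · intro j
      rw [paritySign_add_one, paritySign_sub_one]
      push_cast
      ring

theorem finsum_paritySign_mul_odd_mul_tripleCoeff {R : Type*} [CommRing R] (h : R) (n : ℕ) :
    ∑ᶠ j, ((paritySign j * (2 * j + 1) : ℤ) : R) * tripleCoeff h 1 n j =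
      2 * qPoch h n ^ 2 := by
  induction n with
  | zero =>
    rw [finsum_eq_sum_of_support_subset (s := {0, -1})]
    · rw [Finset.sum_pair (by norm_num)]
      simp [tripleCoeff, paritySign, qPoch]
      norm_num
    · intro j hj
      by_contra hcon
      apply hj
      have : ¬ (j = 0 ∨ j = -1) := by simpa using hcon
      simp [tripleCoeff, this]
  | succ n ih =>
    rw [finsum_mul_tripleCoeff_succ h 1 n
      (fun j => ((paritySign j * (2 * j + 1) : ℤ) : R)) (-2), ih, qPoch_succ]
    · ring
    · intro j
      rw [paritySign_add_one, paritySign_sub_one]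
      push_cast
      ring

/-- The product identity `ψ(q) φ(-q)² = ∑ (-1)^j (2j+1) q^{j(j+1)/2}` with `q = X²`, up to
high powers of `X`. -/
theorem theta_product_congr (n : ℕ) :
    (X : ℤ⟦X⟧) ^ (2 * n + 1) ∣
      (∑ j ∈ Finset.Icc (-(n : ℤ) - 1) n, X ^ (j * (j + 1)).toNat) *
        (∑ y ∈ Finset.Icc (-(n : ℤ)) n, (paritySign y : ℤ⟦X⟧) * X ^ (2 * (y * y).toNat)) ^ 2 -
      ∑ j ∈ Finset.Icc (-(n : ℤ) - 1) n,
        ((paritySign j * (2 * j + 1) : ℤ) : ℤ⟦X⟧) * X ^ (j * (j + 1)).toNat := by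
  have h1 := qPoch_mul_finsum_congr one_ne_zero 1 le_rfl n (fun _ => 1)
  have h2 := qPoch_mul_finsum_congr two_ne_zero 0 zero_le_one n (fun y => (paritySign y : ℤ⟦X⟧))
  have h3 := qPoch_mul_finsum_congr one_ne_zero 1 le_rfl n
    (fun j => ((paritySign j * (2 * j + 1) : ℤ) : ℤ⟦X⟧))
  rw [finsum_one_mul_tripleCoeff] at h1
  rw [finsum_paritySign_mul_tripleCoeff] at h2
  rw [finsum_paritySign_mul_odd_mul_tripleCoeff] at h3
  simp only [pow_one, Nat.cast_one, Nat.cast_zero, sub_zero, add_zero, one_mul, ← pow_mul]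
    at h1 h2 h3
  replace h2 := (pow_dvd_pow (X : ℤ⟦X⟧) (show 2 * n + 1 ≤ 2 * (2 * n + 1) by omega)).trans h2
  set A : ℤ⟦X⟧ := ∏ i ∈ Finset.range n, (1 + X ^ (2 * (i + 1))) with hA
  set O : ℤ⟦X⟧ := ∏ i ∈ Finset.range n, (1 - X ^ (2 * (2 * i + 1))) with hO
  set P : ℤ⟦X⟧ := qPoch X n with hP
  have hP2 : qPoch ((X : ℤ⟦X⟧) ^ 2) n = A * P := by
    rw [hA, hP, qPoch, qPoch, ← Finset.prod_mul_distrib]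
    refine Finset.prod_congr rfl fun i _ => ?_
    ring
  have hO2 : qPoch (X : ℤ⟦X⟧) (2 * n) = O * (A * P) := by
    rw [← hP2, hO]
    clear * -
    induction n with
    | zero => simp [qPoch]
    | succ n ih =>
      rw [show 2 * (n + 1) = 2 * n + 1 + 1 by ring, qPoch_succ, qPoch_succ, qPoch_succ, ih,
        Finset.prod_range_succ]
      ring
  have h4 : (X : ℤ⟦X⟧) ^ (2 * n + 1) ∣ O * A - 1 := by
    have hu : IsUnit P := by simpa using isUnit_qPoch one_ne_zero n
    rw [← hu.dvd_mul_right]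
    have := qPoch_congr (X : ℤ⟦X⟧) (show n ≤ 2 * n by omega)
    rw [hO2, ← hP] at this
    convert (pow_dvd_pow (X : ℤ⟦X⟧) (show 2 * n + 1 ≤ 2 * (n + 1) by omega)).trans this using 1
    ring
  rw [hP2] at h2
  rw [← Ideal.mem_span_singleton, ← Ideal.Quotient.eq] at h1 h2 h3 h4 ⊢
  rw [map_mul, map_pow, ← h1, ← h2, ← h3]
  simp only [map_mul, map_pow, map_one, map_ofNat] at h4 ⊢
  generalize (Ideal.Quotient.mk (Ideal.span {(X : ℤ⟦X⟧) ^ (2 * n + 1)})) O = o at *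
  generalize (Ideal.Quotient.mk (Ideal.span {(X : ℤ⟦X⟧) ^ (2 * n + 1)})) A = a at *
  generalize (Ideal.Quotient.mk (Ideal.span {(X : ℤ⟦X⟧) ^ (2 * n + 1)})) P = p at *
  have h5 : o ^ 4 * a ^ 4 = 1 := by rw [← mul_pow, h4, one_pow]
  linear_combination 2 * p ^ 3 * h5

end

/-- The integer solutions of `j (j + 1) + 2 y² + 2 z² = 2 N`. -/
noncomputable def thetaSolutions (N : ℕ) : Finset (ℤ × ℤ × ℤ) :=
  (Finset.Icc (-(N : ℤ) - 1) N ×ˢ Finset.Icc (-(N : ℤ)) N ×ˢ Finset.Icc (-(N : ℤ)) N).filter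
    fun v => v.1 * (v.1 + 1) + 2 * (v.2.1 * v.2.1) + 2 * (v.2.2 * v.2.2) = 2 * N

theorem mul_add_one_nonneg (j : ℤ) : 0 ≤ j * (j + 1) := by
  rcases le_or_gt 0 j with h | h <;> nlinarith

theorem abs_le_of_mul_self_le {y : ℤ} {N : ℕ} (h : y * y ≤ N) : -(N : ℤ) ≤ y ∧ y ≤ N := by
  constructor <;> nlinarith

theorem mem_thetaSolutions {N : ℕ} {v : ℤ × ℤ × ℤ} :
    v ∈ thetaSolutions N ↔
      v.1 * (v.1 + 1) + 2 * (v.2.1 * v.2.1) + 2 * (v.2.2 * v.2.2) = 2 * N := by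
  obtain ⟨j, y, z⟩ := v
  simp only [thetaSolutions, Finset.mem_filter, Finset.mem_product, Finset.mem_Icc,
    and_iff_right_iff_imp]
  intro h
  have hj := mul_add_one_nonneg j
  have hy := mul_self_nonneg y
  have hz := mul_self_nonneg z
  refine ⟨⟨?_, ?_⟩, abs_le_of_mul_self_le (by linarith), abs_le_of_mul_self_le (by linarith)⟩
  · by_contra hcon
    nlinarith
  · by_contra hcon
    nlinarith

theorem sum_thetaSolutions (N : ℕ) :
    ∑ v ∈ thetaSolutions N, paritySign v.2.1 * paritySign v.2.2 =
      ∑ j ∈ (Finset.Icc (-(N : ℤ) - 1) N).filter (fun j : ℤ => j * (j + 1) = 2 * N),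
        paritySign j * (2 * j + 1) := by
  have h := PowerSeries.X_pow_dvd_iff.mp (theta_product_congr N) (2 * N) (by omega)
  have coeff_term (c : ℤ) (m : ℕ) :
      PowerSeries.coeff (2 * N) ((c : PowerSeries ℤ) * PowerSeries.X ^ m) =
      if m = 2 * N then c else 0 := by
    rw [← zsmul_eq_mul, map_zsmul, PowerSeries.coeff_X_pow]
    simp [eq_comm]
  rw [map_sub, sub_eq_zero, pow_two, Finset.sum_mul_sum, Finset.sum_mul_sum, map_sum, map_sum] at h
  rw [Finset.sum_filter, thetaSolutions, Finset.sum_filter, Finset.sum_product]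
  convert h using 1
  · refine Finset.sum_congr rfl fun j _ => ?_
    rw [Finset.sum_product, map_sum]
    refine Finset.sum_congr rfl fun y _ => ?_
    rw [Finset.mul_sum, map_sum]
    refine Finset.sum_congr rfl fun z _ => ?_
    have : (PowerSeries.X : PowerSeries ℤ) ^ (j * (j + 1)).toNat *
        ((paritySign y : PowerSeries ℤ) * PowerSeries.X ^ (2 * (y * y).toNat) *
        ((paritySign z : PowerSeries ℤ) * PowerSeries.X ^ (2 * (z * z).toNat))) =
        ((paritySign y * paritySign z : ℤ) : PowerSeries ℤ) *
          PowerSeries.X ^ ((j * (j + 1)).toNat + 2 * (y * y).toNat + 2 * (z * z).toNat) := by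
      push_cast
      ring
    rw [this, coeff_term]
    have hj := mul_add_one_nonneg j
    have hy := mul_self_nonneg y
    have hz := mul_self_nonneg z
    refine if_congr ?_ rfl rfl
    simp only
    omega
  · refine Finset.sum_congr rfl fun j _ => ?_
    rw [coeff_term]
    have hj := mul_add_one_nonneg j
    refine if_congr ?_ rfl rfl
    omega

theorem sum_odd_eq_sqTerm (N : ℕ) :
    ((∑ j ∈ (Finset.Icc (-(N : ℤ) - 1) N).filter (fun j : ℤ => j * (j + 1) = 2 * N),
        paritySign j * (2 * j + 1) : ℤ) : ℚ) = 2 * sqTerm (8 * N + 1) := by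
  by_cases hsq : IsSquare (8 * N + 1)
  · obtain ⟨n, hn⟩ := hsq
    have hodd : Odd n := by
      by_contra hcon
      obtain ⟨m, rfl⟩ := Nat.not_odd_iff_even.mp hcon
      have : 8 * N + 1 = 2 * (2 * (m * m)) := by rw [hn]; ring
      omega
    obtain ⟨m, rfl⟩ := hodd
    have hN : (m : ℤ) * (m + 1) = 2 * N := by
      have : m * (m + 1) = 2 * N := by nlinarith
      exact_mod_cast this
    have hset : (Finset.Icc (-(N : ℤ) - 1) N).filter (fun j : ℤ => j * (j + 1) = 2 * N) =
        {(m : ℤ), -(m : ℤ) - 1} := by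
      ext j
      simp only [Finset.mem_filter, Finset.mem_Icc, Finset.mem_insert, Finset.mem_singleton]
      constructor
      · rintro ⟨-, hj⟩
        have : (j - m) * (j + m + 1) = 0 := by linear_combination hj - hN
        rcases mul_eq_zero.mp this with h | h
        · left; linarith
        · right; linarith
      · have hm : (m : ℤ) ≤ N := by
          rcases Nat.eq_zero_or_pos m with rfl | hm
          · simp
          · have : (1 : ℤ) ≤ m := by exact_mod_cast hm
            nlinarith
        rintro (rfl | rfl)
        · exact ⟨⟨by omega, hm⟩, hN⟩
        · exact ⟨⟨by omega, by omega⟩, by linear_combination hN⟩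
    rw [hset, Finset.sum_pair (by omega), sqTerm, if_pos ⟨_, hn⟩, hn, Nat.sqrt_eq]
    have h1 : paritySign (-(m : ℤ) - 1) = -paritySign m := by
      rw [paritySign_sub_one]
      simp [paritySign]
    have h2 : (paritySign m : ℚ) = (-1) ^ m := by
      rcases Nat.even_or_odd m with h | h
      · simp [paritySign, h, h.neg_one_pow]
      · simp [paritySign, Nat.not_even_iff_odd.mpr h, h.neg_one_pow]
    rw [h1, show (2 * m + 1 - 1) / 2 = m by omega]
    push_cast
    rw [h2]
    ring
  · rw [sqTerm, if_neg hsq, Finset.sum_eq_zero]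
    · simp
    · intro j hj
      rw [Finset.mem_filter] at hj
      refine absurd ⟨(2 * j + 1).natAbs, ?_⟩ hsq
      zify
      rw [← abs_mul, abs_mul_self]
      linear_combination -4 * hj.2

/-- The representations of `k` as a sum of three squares. -/
noncomputable def threeSquares (k : ℕ) : Finset (ℤ × ℤ × ℤ) :=
  (Finset.Icc (-(k : ℤ)) k ×ˢ Finset.Icc (-(k : ℤ)) k ×ˢ Finset.Icc (-(k : ℤ)) k).filter
    fun v => v.1 ^ 2 + v.2.1 ^ 2 + v.2.2 ^ 2 = k

theorem mem_threeSquares {k : ℕ} {v : ℤ × ℤ × ℤ} :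
    v ∈ threeSquares k ↔ v.1 ^ 2 + v.2.1 ^ 2 + v.2.2 ^ 2 = k := by
  obtain ⟨x, y, z⟩ := v
  simp only [threeSquares, Finset.mem_filter, Finset.mem_product, Finset.mem_Icc,
    and_iff_right_iff_imp]
  intro h
  have hx := sq_nonneg x
  have hy := sq_nonneg y
  have hz := sq_nonneg z
  exact ⟨abs_le_of_mul_self_le (by linarith), abs_le_of_mul_self_le (by linarith),
    abs_le_of_mul_self_le (by linarith)⟩

theorem r1_eq_card (k : ℕ) : r1 k = (threeSquares k).card :=
  Nat.subtype_card _ fun _ => mem_threeSquares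

/-- The indicator function of the multiples of four. -/
def fourInd (x : ℤ) : ℤ := if 4 ∣ x then 1 else 0

theorem sum_threeSquares_rotate (k : ℕ) (f : ℤ → ℤ → ℤ → ℤ) :
    ∑ v ∈ threeSquares k, f v.2.1 v.2.2 v.1 = ∑ v ∈ threeSquares k, f v.1 v.2.1 v.2.2 := by
  refine Finset.sum_nbij' (fun v => (v.2.1, v.2.2, v.1)) (fun v => (v.2.2, v.1, v.2.1))
    ?_ ?_ ?_ ?_ ?_
  · intro v hv
    rw [mem_threeSquares] at hv ⊢
    linarith
  · intro v hv
    rw [mem_threeSquares] at hv ⊢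
    linarith
  all_goals simp

theorem card_sixteen_eq_sum (k : ℕ) :
    (Nat.card {v : ℤ × ℤ × ℤ // v.1 ^ 2 + v.2.1 ^ 2 + 16 * v.2.2 ^ 2 = (k : ℤ)} : ℤ) =
      ∑ v ∈ threeSquares k, fourInd v.2.2 := by
  simp only [fourInd]
  rw [← Finset.sum_filter, Finset.sum_const, nsmul_eq_mul, mul_one, Nat.cast_inj,
    ← Nat.subtype_card (p := fun v : ℤ × ℤ × ℤ => v.1 ^ 2 + v.2.1 ^ 2 + v.2.2 ^ 2 = k ∧ 4 ∣ v.2.2)]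
  · refine Nat.card_congr
      { toFun := fun v => ⟨(v.1.1, v.1.2.1, 4 * v.1.2.2), by linarith [v.2], Dvd.intro _ rfl⟩
        invFun := fun v => ⟨(v.1.1, v.1.2.1, v.1.2.2 / 4), ?_⟩
        left_inv := ?_
        right_inv := ?_ }
    · obtain ⟨⟨x, y, z⟩, h, w, hw⟩ := v
      simp only at hw h ⊢
      subst hw
      rw [Int.mul_ediv_cancel_left _ (by norm_num)]
      linarith
    · rintro ⟨⟨x, y, z⟩, h⟩
      simp
    · rintro ⟨⟨x, y, z⟩, h, w, hw⟩
      simp only at hw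
      subst hw
      simp
  · intro v
    rw [Finset.mem_filter, mem_threeSquares]

theorem three_mul_card_sixteen (k : ℕ) :
    3 * (Nat.card {v : ℤ × ℤ × ℤ // v.1 ^ 2 + v.2.1 ^ 2 + 16 * v.2.2 ^ 2 = (k : ℤ)} : ℤ) =
      ∑ v ∈ threeSquares k, (fourInd v.1 + fourInd v.2.1 + fourInd v.2.2) := by
  rw [Finset.sum_add_distrib, Finset.sum_add_distrib, card_sixteen_eq_sum]
  have h1 := sum_threeSquares_rotate k fun _ _ z => fourInd z
  have h2 := sum_threeSquares_rotate k fun _ y _ => fourInd y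
  linarith

theorem sq_emod_sixteen (x : ℤ) :
    (fourInd x = 1 ∧ x ^ 2 % 16 = 0) ∨
      (fourInd x = 0 ∧ (x ^ 2 % 16 = 4 ∨ x ^ 2 % 16 = 1 ∨ x ^ 2 % 16 = 9)) := by
  have h : x ^ 2 % 16 = (x % 16) ^ 2 % 16 := by simp [pow_two, Int.mul_emod]
  have h1 : fourInd x = if x % 16 % 4 = 0 then 1 else 0 := by
    unfold fourInd
    refine if_congr ?_ rfl rfl
    omega
  rw [h, h1]
  have h2 : 0 ≤ x % 16 := by omega
  have h3 : x % 16 < 16 := by omega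
  generalize x % 16 = r at *
  interval_cases r <;> simp

theorem sq_emod_eight (x : ℤ) :
    (x % 4 = 0 ∧ fourInd x = 1 ∧ x ^ 2 % 8 = 0) ∨ (x % 4 = 2 ∧ fourInd x = 0 ∧ x ^ 2 % 8 = 4) ∨
      (x % 2 = 1 ∧ fourInd x = 0 ∧ x ^ 2 % 8 = 1) := by
  have h : x ^ 2 % 8 = (x % 8) ^ 2 % 8 := by simp [pow_two, Int.mul_emod]
  have h1 : fourInd x = if x % 8 % 4 = 0 then 1 else 0 := by
    unfold fourInd
    refine if_congr ?_ rfl rfl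
    omega
  rw [h, h1, show x % 4 = x % 8 % 4 by omega, show x % 2 = x % 8 % 2 by omega]
  have h2 : 0 ≤ x % 8 := by omega
  have h3 : x % 8 < 8 := by omega
  generalize x % 8 = r at *
  interval_cases r <;> simp

theorem three_mul_card_sixteen_of_forall (k : ℕ) (c : ℤ)
    (hc : ∀ x y z : ℤ, x ^ 2 + y ^ 2 + z ^ 2 = k → fourInd x + fourInd y + fourInd z = c) :
    3 * (Nat.card {v : ℤ × ℤ × ℤ // v.1 ^ 2 + v.2.1 ^ 2 + 16 * v.2.2 ^ 2 = (k : ℤ)} : ℚ) =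
      c * r1 k := by
  have h := three_mul_card_sixteen k
  rw [Finset.sum_congr rfl fun v hv => hc _ _ _ (mem_threeSquares.mp hv), Finset.sum_const,
    ← r1_eq_card, nsmul_eq_mul] at h
  rw [mul_comm (c : ℚ)]
  exact_mod_cast h

theorem card_sixteen_eq_zero (k : ℕ)
    (hc : ∀ x y z : ℤ, x ^ 2 + y ^ 2 + 16 * z ^ 2 ≠ k) :
    Nat.card {v : ℤ × ℤ × ℤ // v.1 ^ 2 + v.2.1 ^ 2 + 16 * v.2.2 ^ 2 = (k : ℤ)} = 0 := by
  have : IsEmpty {v : ℤ × ℤ × ℤ // v.1 ^ 2 + v.2.1 ^ 2 + 16 * v.2.2 ^ 2 = (k : ℤ)} :=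
    ⟨fun v => hc _ _ _ v.2⟩
  exact Nat.card_of_isEmpty

theorem exists_of_mem_threeSquares {N : ℕ} {x y z : ℤ}
    (h : x ^ 2 + y ^ 2 + z ^ 2 = 8 * N + 1) (hx : Odd x) :
    ∃ j u w, x = 2 * j + 1 ∧ y = 2 * (u + w) ∧ z = 2 * (u - w) := by
  have hx' := sq_emod_eight x
  have hy := sq_emod_eight y
  have hz := sq_emod_eight z
  rw [Int.odd_iff] at hx
  exact ⟨x / 2, (y + z) / 4, (y - z) / 4, by omega, by omega, by omega⟩

/-- The signed count of the representations whose first coordinate is odd. -/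
theorem sum_threeSquares_odd (N : ℕ) :
    ∑ v ∈ threeSquares (8 * N + 1), (if Odd v.1 then fourInd v.2.1 + fourInd v.2.2 - 1 else 0) =
      ∑ v ∈ thetaSolutions N, paritySign v.2.1 * paritySign v.2.2 := by
  rw [← Finset.sum_filter]
  symm
  refine Finset.sum_nbij' (fun v => (2 * v.1 + 1, 2 * (v.2.1 + v.2.2), 2 * (v.2.1 - v.2.2)))
    (fun v => ((v.1 - 1) / 2, (v.2.1 + v.2.2) / 4, (v.2.1 - v.2.2) / 4)) ?_ ?_ ?_ ?_ ?_
  · rintro ⟨j, y, z⟩ hv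
    rw [mem_thetaSolutions] at hv
    rw [Finset.mem_filter, mem_threeSquares]
    push_cast
    refine ⟨?_, j, rfl⟩
    simp only at hv ⊢
    linear_combination 4 * hv
  · rintro ⟨x, y, z⟩ hv
    rw [Finset.mem_filter, mem_threeSquares] at hv
    push_cast at hv
    obtain ⟨j, u, w, rfl, rfl, rfl⟩ := exists_of_mem_threeSquares hv.1 hv.2
    rw [mem_thetaSolutions]
    simp only at hv ⊢
    rw [show (2 * j + 1 - 1) / 2 = j by omega, show (2 * (u + w) + 2 * (u - w)) / 4 = u by omega,
      show (2 * (u + w) - 2 * (u - w)) / 4 = w by omega]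
    linarith [hv.1]
  · rintro ⟨j, y, z⟩ hv
    simp only [Prod.mk.injEq]
    omega
  · rintro ⟨x, y, z⟩ hv
    rw [Finset.mem_filter, mem_threeSquares] at hv
    push_cast at hv
    obtain ⟨j, u, w, rfl, rfl, rfl⟩ := exists_of_mem_threeSquares hv.1 hv.2
    simp only [Prod.mk.injEq]
    omega
  · rintro ⟨j, y, z⟩ -
    have h1 : (4 ∣ 2 * (y + z)) ↔ (Even y ↔ Even z) := by
      rw [← Int.even_add, Int.even_iff]
      omega
    have h2 : (4 ∣ 2 * (y - z)) ↔ (Even y ↔ Even z) := by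
      rw [← Int.even_sub, Int.even_iff]
      omega
    simp only [fourInd, paritySign, h1, h2]
    by_cases hy : Even y <;> by_cases hz : Even z <;> simp [hy, hz]

theorem three_mul_card_sixteen_of_one_mod_eight (N : ℕ) :
    3 * (Nat.card {v : ℤ × ℤ × ℤ // v.1 ^ 2 + v.2.1 ^ 2 + 16 * v.2.2 ^ 2 =
      ((8 * N + 1 : ℕ) : ℤ)} : ℚ) = r1 (8 * N + 1) + 6 * sqTerm (8 * N + 1) := by
  let g : ℤ → ℤ → ℤ → ℤ := fun x y z => if Odd x then fourInd y + fourInd z - 1 else 0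
  have key : ∀ v ∈ threeSquares (8 * N + 1), fourInd v.1 + fourInd v.2.1 + fourInd v.2.2 =
      1 + g v.1 v.2.1 v.2.2 + g v.2.1 v.2.2 v.1 + g v.2.2 v.1 v.2.1 := by
    rintro ⟨x, y, z⟩ hv
    rw [mem_threeSquares] at hv
    push_cast at hv
    have hx := sq_emod_eight x
    have hy := sq_emod_eight y
    have hz := sq_emod_eight z
    simp only [g, Int.odd_iff] at hv ⊢
    split_ifs <;> omega
  have h := three_mul_card_sixteen (8 * N + 1)
  have h1 := sum_threeSquares_rotate (8 * N + 1) g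
  have h2 := sum_threeSquares_rotate (8 * N + 1) fun x y z => g y z x
  rw [Finset.sum_congr rfl key, Finset.sum_add_distrib, Finset.sum_add_distrib,
    Finset.sum_add_distrib, h2, h1, Finset.sum_const, ← r1_eq_card, nsmul_eq_mul, mul_one,
    sum_threeSquares_odd, sum_thetaSolutions] at h
  have h' := congrArg (Int.cast : ℤ → ℚ) h
  rw [Int.cast_add, Int.cast_add, Int.cast_add, sum_odd_eq_sqTerm] at h'
  push_cast at h' ⊢
  linarith

theorem stmt_0 (a t α : ℕ) (hα : α = 1 ∨ α = 3 ∨ α = 5 ∨ α = 7)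
    (k : ℕ) (hk : k = 2 ^ a * (8 * t + α)) :
    (Nat.card {v : ℤ × ℤ × ℤ // v.1 ^ 2 + v.2.1 ^ 2 + 16 * v.2.2 ^ 2 = (k : ℤ)} : ℚ) =
      if a = 0 ∧ α = 1 then (1 / 3 : ℚ) * r1 k + 2 * sqTerm k
      else if (a = 0 ∧ α = 5) ∨ (a = 1 ∧ α = 1) ∨ (a = 1 ∧ α = 5) ∨ a = 3 then
        (1 / 3 : ℚ) * r1 k
      else if (a = 2 ∧ α = 1) ∨ (a = 2 ∧ α = 5) then (2 / 3 : ℚ) * r1 k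
      else if 4 ≤ a then (r1 k : ℚ)
      else 0 := by
  split_ifs with h1 h2 h3 h4
  · obtain ⟨rfl, rfl⟩ := h1
    rw [pow_zero, one_mul] at hk
    subst hk
    have := three_mul_card_sixteen_of_one_mod_eight t
    linarith
  · have hk' : (k : ℤ) % 8 = 5 ∨ (k : ℤ) % 8 = 2 ∨ (k : ℤ) % 16 = 8 := by
      rcases h2 with ⟨rfl, rfl⟩ | ⟨rfl, rfl⟩ | ⟨rfl, rfl⟩ | rfl <;> omega
    have := three_mul_card_sixteen_of_forall k 1 fun x y z hxyz => by
      have hx := sq_emod_sixteen x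
      have hy := sq_emod_sixteen y
      have hz := sq_emod_sixteen z
      omega
    push_cast at this
    linarith
  · have hk' : (k : ℤ) % 16 = 4 := by
      rcases h3 with ⟨rfl, rfl⟩ | ⟨rfl, rfl⟩ <;> omega
    have := three_mul_card_sixteen_of_forall k 2 fun x y z hxyz => by
      have hx := sq_emod_sixteen x
      have hy := sq_emod_sixteen y
      have hz := sq_emod_sixteen z
      omega
    push_cast at this
    linarith
  · have hk' : (k : ℤ) % 16 = 0 := by
      obtain ⟨b, rfl⟩ := Nat.exists_eq_add_of_le h4
      rw [hk, pow_add, mul_assoc]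
      generalize 2 ^ b * (8 * t + α) = m
      omega
    have := three_mul_card_sixteen_of_forall k 3 fun x y z hxyz => by
      have hx := sq_emod_sixteen x
      have hy := sq_emod_sixteen y
      have hz := sq_emod_sixteen z
      omega
    push_cast at this
    linarith
  · have hk' : (k : ℤ) % 4 = 3 ∨ (k : ℤ) % 8 = 6 ∨ (k : ℤ) % 16 = 12 := by
      have : a = 0 ∨ a = 1 ∨ a = 2 := by omega
      rcases this with rfl | rfl | rfl <;> omega
    rw [card_sixteen_eq_zero, Nat.cast_zero]
    intro x y z hxyz
    have hx := sq_emod_sixteen x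
    have hy := sq_emod_sixteen y
    omega
end

section
/- Let k be a positive integer written uniquely as k = 2^a(8t+α) with a,t nonnegative integers and α ∈ {1,3,5,7}. Then the number of (x,y,z) ∈ ℤ³ with x²+4y²+16z² = k equals: (1/6)𝔯₁(k) + δ_□(k)·(−1)^((√k−1)/2)·√k if (a,α) = (0,1); (1/6)𝔯₁(k) if (a,α) = (0,5); (2/3)𝔯₁(k) if (a,α) ∈ {(2,1),(2,5)}; (1/3)𝔯₁(k) if a = 3 (with any α); 𝔯₁(k) if a ≥ 4; and 0 in all remaining cases. -/
section

open PowerSeries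

/-- The generating series `∑ i, w i * X ^ f i`, with coefficients computed as finite sums. -/
noncomputable def genSeries {ι : Type*} (f w : ι → ℤ) : ℤ⟦X⟧ :=
  PowerSeries.mk fun n => ∑ᶠ i ∈ {i | f i = (n : ℤ)}, w i

/-- An integer-valued function that is nonnegative with finite sublevel sets. -/
def IsProperNonneg {ι : Type*} (f : ι → ℤ) : Prop :=
  (∀ i, 0 ≤ f i) ∧ ∀ N : ℤ, {i | f i ≤ N}.Finite

section GenSeries

variable {ι κ : Type*} {f : ι → ℤ} {g : κ → ℤ}

theorem IsProperNonneg.fiber_finite (hf : IsProperNonneg f) (n : ℤ) : {i | f i = n}.Finite :=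
  (hf.2 n).subset fun _ hi => le_of_eq hi

theorem IsProperNonneg.add (hf : IsProperNonneg f) (hg : IsProperNonneg g) :
    IsProperNonneg fun p : ι × κ => f p.1 + g p.2 := by
  refine ⟨fun p => add_nonneg (hf.1 _) (hg.1 _), fun N => ?_⟩
  refine ((hf.2 N).prod (hg.2 N)).subset fun p hp => ?_
  have h1 := hf.1 p.1
  have h2 := hg.1 p.2
  simp only [Set.mem_ofPred_eq, Set.mem_prod] at hp ⊢
  constructor <;> linarith

theorem IsProperNonneg.const_mul (hf : IsProperNonneg f) {c : ℤ} (hc : 0 < c) :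
    IsProperNonneg fun i => c * f i := by
  refine ⟨fun i => mul_nonneg hc.le (hf.1 _), fun N => (hf.2 N).subset fun i hi => ?_⟩
  have h1 := hf.1 i
  simp only [Set.mem_ofPred_eq] at hi ⊢
  nlinarith

theorem coeff_genSeries (f w : ι → ℤ) (n : ℕ) :
    coeff n (genSeries f w) = ∑ᶠ i ∈ {i | f i = (n : ℤ)}, w i := by
  simp [genSeries]

theorem coeff_genSeries_eq_sum (w : ι → ℤ) {n : ℕ} {s : Finset ι}
    (hs : ∀ i, f i = (n : ℤ) → i ∈ s) :
    coeff n (genSeries f w) = ∑ i ∈ s, if f i = (n : ℤ) then w i else 0 := by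
  classical
  rw [coeff_genSeries, ← Finset.sum_filter]
  refine finsum_mem_eq_sum_of_inter_support_eq _ ?_
  ext i
  simp only [Set.mem_inter_iff, Set.mem_ofPred_eq, Finset.coe_filter]
  exact ⟨fun h => ⟨⟨hs i h.1, h.1⟩, h.2⟩, fun h => ⟨h.1.2, h.2⟩⟩

theorem genSeries_mul (hf : IsProperNonneg f) (hg : IsProperNonneg g) (w : ι → ℤ) (v : κ → ℤ) :
    genSeries f w * genSeries g v =
      genSeries (fun p : ι × κ => f p.1 + g p.2) fun p => w p.1 * v p.2 := by
  classical
  ext n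
  have hfs : ∀ a : ℕ, a ≤ n → ∀ i, f i = (a : ℤ) → i ∈ (hf.2 n).toFinset := by
    intro a ha i hi
    simp only [Set.Finite.mem_toFinset, Set.mem_ofPred_eq]
    omega
  have hgs : ∀ a : ℕ, a ≤ n → ∀ i, g i = (a : ℤ) → i ∈ (hg.2 n).toFinset := by
    intro a ha i hi
    simp only [Set.Finite.mem_toFinset, Set.mem_ofPred_eq]
    omega
  rw [coeff_mul, coeff_genSeries_eq_sum (s := (hf.2 n).toFinset ×ˢ (hg.2 n).toFinset)]
  · have h1 : ∀ p ∈ Finset.HasAntidiagonal.antidiagonal n,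
        coeff p.1 (genSeries f w) * coeff p.2 (genSeries g v) =
        ∑ q ∈ (hf.2 n).toFinset ×ˢ (hg.2 n).toFinset,
          if f q.1 = (p.1 : ℤ) ∧ g q.2 = (p.2 : ℤ) then w q.1 * v q.2 else 0 := by
      intro p hp
      rw [Finset.HasAntidiagonal.mem_antidiagonal] at hp
      rw [coeff_genSeries_eq_sum w (hfs p.1 (by omega)),
        coeff_genSeries_eq_sum v (hgs p.2 (by omega)), Finset.sum_mul_sum, Finset.sum_product]
      refine Finset.sum_congr rfl fun i _ => Finset.sum_congr rfl fun j _ => ?_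
      simp only [ite_and]
      split_ifs <;> simp
    rw [Finset.sum_congr rfl h1, Finset.sum_comm]
    refine Finset.sum_congr rfl fun q _ => ?_
    have hq1 := hf.1 q.1
    have hq2 := hg.1 q.2
    by_cases h : f q.1 + g q.2 = n
    · rw [if_pos h, Finset.sum_eq_single ((f q.1).toNat, (g q.2).toNat)]
      · rw [if_pos]
        constructor <;> simp [hq1, hq2]
      · intro p _ hp
        rw [if_neg]
        rintro ⟨h1, h2⟩
        exact hp (Prod.ext (by simp [h1]) (by simp [h2]))
      · intro hn
        refine absurd ?_ hn
        rw [Finset.HasAntidiagonal.mem_antidiagonal]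
        omega
    · rw [if_neg h]
      refine Finset.sum_eq_zero fun p hp => if_neg ?_
      rw [Finset.HasAntidiagonal.mem_antidiagonal] at hp
      omega
  · rintro ⟨i, j⟩ h
    have hq1 := hf.1 i
    have hq2 := hg.1 j
    simp only [Finset.mem_product, Set.Finite.mem_toFinset, Set.mem_ofPred_eq] at h ⊢
    constructor <;> linarith

theorem genSeries_add (hf : IsProperNonneg f) (w v : ι → ℤ) :
    genSeries f (fun i => w i + v i) = genSeries f w + genSeries f v := by
  ext n
  simp only [map_add, coeff_genSeries]
  exact finsum_mem_add_distrib (hf.fiber_finite n)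

theorem genSeries_comp_injective {w : ι → ℤ} {e : κ → ι} (he : Function.Injective e)
    (hw : ∀ i, i ∉ Set.range e → w i = 0) :
    genSeries (fun j => f (e j)) (fun j => w (e j)) = genSeries f w := by
  ext n
  simp only [coeff_genSeries]
  rw [← finsum_mem_image (s := {j | f (e j) = (n : ℤ)}) he.injOn]
  refine finsum_mem_inter_support_eq _ _ _ ?_
  ext i
  simp only [Set.mem_inter_iff, Set.mem_image, Set.mem_ofPred_eq, Function.mem_support]
  constructor
  · rintro ⟨⟨j, hj, rfl⟩, h⟩
    exact ⟨hj, h⟩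
  · rintro ⟨hi, h⟩
    obtain ⟨j, rfl⟩ := not_imp_comm.1 (hw i) h
    exact ⟨⟨j, hi, rfl⟩, h⟩

theorem genSeries_comp_equiv (e : ι ≃ ι) (hfe : ∀ i, f (e i) = f i) (w : ι → ℤ) :
    genSeries f (fun i => w (e i)) = genSeries f w := by
  rw [← genSeries_comp_injective (f := f) (w := w) e.injective
    fun i hi => absurd (e.surjective i) hi]
  simp only [hfe]

theorem coeff_genSeries_two_mul (w : ι → ℤ) (n : ℕ) :
    coeff (2 * n) (genSeries (fun i => 2 * f i) w) = coeff n (genSeries f w) := by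
  simp [coeff_genSeries]

theorem coeff_genSeries_two_mul_of_odd (w : ι → ℤ) {n : ℕ} (hn : Odd n) :
    coeff n (genSeries (fun i => 2 * f i) w) = 0 := by
  rw [coeff_genSeries]
  obtain ⟨m, rfl⟩ := hn
  have : {i | 2 * f i = ((2 * m + 1 : ℕ) : ℤ)} = ∅ := by
    ext i
    simp only [Set.mem_ofPred_eq, Set.mem_empty_iff_false, iff_false]
    omega
  rw [this, finsum_mem_empty]

end GenSeries

theorem isProperNonneg_sq_of_abs_le {h : ℤ → ℤ} (h1 : ∀ n, |n| ≤ h n ^ 2 + 1) :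
    IsProperNonneg fun n => h n ^ 2 := by
  refine ⟨fun n => sq_nonneg _, fun N => (Set.finite_Icc (-(N + 1)) (N + 1)).subset fun n hn => ?_⟩
  have := h1 n
  simp only [Set.mem_ofPred_eq] at hn
  rw [Set.mem_Icc, ← abs_le]
  linarith

theorem isProperNonneg_odd_sq : IsProperNonneg fun n : ℤ => (2 * n + 1) ^ 2 :=
  isProperNonneg_sq_of_abs_le fun n => abs_le.2 ⟨by nlinarith, by nlinarith⟩

theorem isProperNonneg_even_sq : IsProperNonneg fun n : ℤ => (2 * n) ^ 2 :=
  isProperNonneg_sq_of_abs_le fun n => abs_le.2 ⟨by nlinarith, by nlinarith⟩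

section Theta

theorem two_ne_zero_powerSeries : (2 : ℤ⟦X⟧) ≠ 0 := fun h => by
  have := congrArg constantCoeff h
  rw [map_ofNat, map_zero] at this
  norm_num at this

theorem two_smul_genSeries {ι : Type*} {f : ι → ℤ} (hf : IsProperNonneg f) (w : ι → ℤ) :
    genSeries f (fun i => 2 * w i) = 2 * genSeries f w := by
  simp only [two_mul, genSeries_add hf]

theorem injective_add_sub : Function.Injective fun p : ℤ × ℤ => (p.1 + p.2, p.1 - p.2) := by
  rintro ⟨a, b⟩ ⟨c, d⟩ h
  simp only [Prod.mk.injEq] at h ⊢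
  omega

theorem even_add_of_notMem_range_add_sub {p : ℤ × ℤ}
    (h : p ∉ Set.range fun p : ℤ × ℤ => (p.1 + p.2, p.1 - p.2)) : ¬ Even (p.1 + p.2) := by
  rintro ⟨r, hr⟩
  exact h ⟨(r, p.1 - r), Prod.ext (by simp) (by simp only; omega)⟩

theorem negOnePow_cast_add (a b : ℤ) :
    (((a + b).negOnePow : ℤˣ) : ℤ) = (a.negOnePow : ℤˣ) * (b.negOnePow : ℤˣ) := by
  rw [Int.negOnePow_add, Units.val_mul]

theorem negOnePow_cast_sub (a b : ℤ) :
    (((a - b).negOnePow : ℤˣ) : ℤ) = (a.negOnePow : ℤˣ) * (b.negOnePow : ℤˣ) := by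
  rw [Int.negOnePow_sub, Units.val_mul]

/-- A sum over pairs of odd squares with weight invariant under a sign change of the second
coordinate only needs the pairs `(2 * (i + j) + 1, 2 * (i - j) + 1)`. -/
theorem genSeries_odd_sq_add_odd_sq {W : ℤ × ℤ → ℤ} (hW : ∀ p, W (p.1, -1 - p.2) = W p) :
    genSeries (fun p : ℤ × ℤ => (2 * p.1 + 1) ^ 2 + (2 * p.2 + 1) ^ 2) W =
      2 * genSeries (fun p : ℤ × ℤ => 2 * (2 * p.1 + 1) ^ 2 + 2 * (2 * p.2) ^ 2)
        fun p => W (p.1 + p.2, p.1 - p.2) := by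
  classical
  have hf := isProperNonneg_odd_sq.add isProperNonneg_odd_sq
  let V : ℤ × ℤ → ℤ := fun p => if Even (p.1 + p.2) then W p else 0
  let e : ℤ × ℤ ≃ ℤ × ℤ := (Equiv.refl ℤ).prodCongr (Equiv.subLeft (-1))
  have he : ∀ p, e p = (p.1, -1 - p.2) := fun p => rfl
  have hsplit : W = fun p => V p + V (e p) := by
    ext p
    have : Even (p.1 + (-1 - p.2)) ↔ ¬ Even (p.1 + p.2) := by
      simp only [Int.even_iff]; omega
    simp only [V, he, hW, this]
    split_ifs <;> simp
  have hV : genSeries (fun p : ℤ × ℤ => 2 * (2 * p.1 + 1) ^ 2 + 2 * (2 * p.2) ^ 2)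
      (fun p => W (p.1 + p.2, p.1 - p.2)) =
      genSeries (fun p : ℤ × ℤ => (2 * p.1 + 1) ^ 2 + (2 * p.2 + 1) ^ 2) V := by
    rw [← genSeries_comp_injective injective_add_sub
      (fun p hp => if_neg (even_add_of_notMem_range_add_sub hp))]
    congr 1
    · ext p; ring
    · ext p
      exact (if_pos ⟨p.1, by ring⟩).symm
  rw [hV, two_mul]
  conv_lhs => rw [hsplit]
  rw [genSeries_add hf, genSeries_comp_equiv e]
  intro p
  simp only [he]
  ring

theorem odd_theta_sq :
    genSeries (fun n : ℤ => (2 * n + 1) ^ 2) 1 * genSeries (fun n : ℤ => (2 * n + 1) ^ 2) 1 =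
      2 * (genSeries (fun n : ℤ => 2 * (2 * n + 1) ^ 2) 1 *
        genSeries (fun n : ℤ => 2 * (2 * n) ^ 2) 1) := by
  rw [genSeries_mul isProperNonneg_odd_sq isProperNonneg_odd_sq,
    genSeries_mul (isProperNonneg_odd_sq.const_mul two_pos)
      (isProperNonneg_even_sq.const_mul two_pos), genSeries_odd_sq_add_odd_sq (fun p => rfl)]
  rfl

theorem theta_deriv_mul_odd_theta :
    genSeries (fun n : ℤ => (2 * n + 1) ^ 2) (fun n => n.negOnePow * (2 * n + 1)) *
        genSeries (fun n : ℤ => (2 * n + 1) ^ 2) 1 =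
      2 * (genSeries (fun n : ℤ => 2 * (2 * n + 1) ^ 2) (fun n => n.negOnePow * (2 * n + 1)) *
        genSeries (fun n : ℤ => 2 * (2 * n) ^ 2) fun n => n.negOnePow) := by
  have hf := isProperNonneg_odd_sq.add isProperNonneg_odd_sq
  have hg := (isProperNonneg_odd_sq.const_mul two_pos).add
      (isProperNonneg_even_sq.const_mul two_pos)
  rw [genSeries_mul isProperNonneg_odd_sq isProperNonneg_odd_sq,
    genSeries_mul (isProperNonneg_odd_sq.const_mul two_pos)
      (isProperNonneg_even_sq.const_mul two_pos)]
  refine mul_left_cancel₀ two_ne_zero_powerSeries ?_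
  have hswap := genSeries_comp_equiv (Equiv.prodComm ℤ ℤ)
    (f := fun p : ℤ × ℤ => (2 * p.1 + 1) ^ 2 + (2 * p.2 + 1) ^ 2) (fun p => add_comm _ _)
    (fun p => p.1.negOnePow * (2 * p.1 + 1) * (1 : ℤ → ℤ) p.2)
  conv_lhs => rw [two_mul]
  conv_lhs =>
    enter [2]
    rw [← hswap]
  rw [← genSeries_add hf, genSeries_odd_sq_add_odd_sq]
  · congr 1
    rw [← two_smul_genSeries hg]
    congr 1
    ext p
    simp only [Equiv.prodComm_apply, Prod.fst_swap, Pi.one_apply, negOnePow_cast_add,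
      negOnePow_cast_sub]
    ring
  · intro p
    have : (((-1 - p.2).negOnePow : ℤˣ) : ℤ) = - (p.2.negOnePow : ℤˣ) := by
      rw [negOnePow_cast_sub]; simp
    simp only [Equiv.prodComm_apply, Prod.fst_swap, Pi.one_apply, this]
    ring

theorem alternating_theta_mul_theta :
    genSeries (fun n : ℤ => (2 * n) ^ 2) (fun n => n.negOnePow) *
        genSeries (fun n : ℤ => (2 * n) ^ 2) 1 =
      genSeries (fun n : ℤ => 2 * (2 * n) ^ 2) (fun n => n.negOnePow) *
        genSeries (fun n : ℤ => 2 * (2 * n) ^ 2) (fun n => n.negOnePow) := by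
  have hf := isProperNonneg_even_sq.add isProperNonneg_even_sq
  have he := isProperNonneg_even_sq.const_mul two_pos
  rw [genSeries_mul isProperNonneg_even_sq isProperNonneg_even_sq, genSeries_mul he he]
  refine mul_left_cancel₀ two_ne_zero_powerSeries ?_
  have hswap := genSeries_comp_equiv (Equiv.prodComm ℤ ℤ)
    (f := fun p : ℤ × ℤ => (2 * p.1) ^ 2 + (2 * p.2) ^ 2) (fun p => add_comm _ _)
    (fun p => p.1.negOnePow * (1 : ℤ → ℤ) p.2)
  conv_lhs => rw [two_mul]
  conv_lhs =>
    enter [2]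
    rw [← hswap]
  rw [← genSeries_add hf, ← two_smul_genSeries (he.add he),
    ← genSeries_comp_injective injective_add_sub]
  · congr 1
    · ext p; ring
    · ext p
      simp only [Equiv.prodComm_apply, Prod.fst_swap, Pi.one_apply, negOnePow_cast_add,
        negOnePow_cast_sub]
      ring
  · intro p hp
    have h := even_add_of_notMem_range_add_sub hp
    rw [Int.not_even_iff_odd] at h
    have h' : Odd (p.1 - p.2) := by
      rw [Int.odd_iff] at h ⊢; omega
    have h2 := congrArg (fun u : ℤˣ => (u : ℤ)) (Int.negOnePow_odd _ h')
    simp only [negOnePow_cast_sub] at h2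
    have h3 : ((p.2.negOnePow : ℤˣ) : ℤ) * (p.2.negOnePow : ℤˣ) = 1 := by
      rw [← Units.val_mul]; simp
    simp only [Equiv.prodComm_apply, Prod.fst_swap, Pi.one_apply]
    simp only [Units.val_neg, Units.val_one] at h2
    linear_combination (p.2.negOnePow : ℤˣ) * h2 - (p.1.negOnePow : ℤˣ) * h3

theorem finsum_odd_sq_eq {j N : ℤ} (hN : N = (2 * j + 1) ^ 2) (w : ℤ → ℤ) :
    ∑ᶠ n ∈ {n : ℤ | (2 * n + 1) ^ 2 = N}, w n = w j + w (-1 - j) := by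
  have : {n : ℤ | (2 * n + 1) ^ 2 = N} = {j, -1 - j} := by
    ext n
    simp only [Set.mem_ofPred_eq, Set.mem_insert_iff, Set.mem_singleton_iff, hN,
      sq_eq_sq_iff_eq_or_eq_neg]
    omega
  rw [this, finsum_mem_pair (by omega)]

theorem coeff_zero_odd_theta (w : ℤ → ℤ) :
    coeff 0 (genSeries (fun n : ℤ => (2 * n + 1) ^ 2) w) = 0 := by
  have : {n : ℤ | (2 * n + 1) ^ 2 = ((0 : ℕ) : ℤ)} = ∅ := by
    ext n
    simp only [Set.mem_ofPred_eq, Set.mem_empty_iff_false, iff_false, Nat.cast_zero,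
      sq_eq_zero_iff]
    omega
  rw [coeff_genSeries, this, finsum_mem_empty]

theorem coeff_zero_even_theta (w : ℤ → ℤ) :
    coeff 0 (genSeries (fun n : ℤ => (2 * n) ^ 2) w) = w 0 := by
  have : {n : ℤ | (2 * n) ^ 2 = ((0 : ℕ) : ℤ)} = {0} := by
    ext n
    simp
  rw [coeff_genSeries, this, finsum_mem_singleton]

/-- A form of the statement that `F / D` is constant if it is invariant under `X ↦ X ^ 2`. -/
theorem eq_zero_of_mul_eq_mul {F F₂ D D₂ : ℤ⟦X⟧} (h : F * D₂ = D * F₂)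
    (hF : ∀ n, coeff (2 * n) F₂ = coeff n F) (hF' : ∀ n, Odd n → coeff n F₂ = 0)
    (hD : ∀ n, coeff (2 * n) D₂ = coeff n D) (hD' : ∀ n, Odd n → coeff n D₂ = 0)
    (hD0 : coeff 0 D = 0) (hD1 : coeff 1 D ≠ 0) (hF0 : coeff 0 F = 0) (hF1 : coeff 1 F = 0) :
    F = 0 := by
  ext m
  rw [map_zero]
  induction m using Nat.strong_induction_on with
  | _ m ih =>
  rcases Nat.lt_or_ge m 2 with hm | hm
  · interval_cases m
    exacts [hF0, hF1]
  have hc := congrArg (coeff (m + 2)) h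
  rw [coeff_mul, coeff_mul, Finset.sum_eq_single (m, 2), Finset.sum_eq_zero] at hc
  · have h2 := hD 1
    rw [mul_one] at h2
    rw [h2] at hc
    exact (mul_eq_zero.1 hc).resolve_right hD1
  · rintro ⟨i, j⟩ hp
    rw [Finset.HasAntidiagonal.mem_antidiagonal] at hp
    simp only at hp ⊢
    rcases Nat.even_or_odd' j with ⟨l, rfl | rfl⟩
    · rw [hF]
      rcases Nat.lt_or_ge l m with hl | hl
      · rw [ih l hl, mul_zero]
      · rw [show i = 0 by omega, hD0, zero_mul]
    · rw [hF' _ ⟨l, rfl⟩, mul_zero]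
  · rintro ⟨i, j⟩ hp hne
    rw [Finset.HasAntidiagonal.mem_antidiagonal] at hp
    simp only [ne_eq, Prod.mk.injEq, not_and] at hp hne ⊢
    rcases Nat.lt_or_ge i m with hi | hi
    · rw [ih i hi, zero_mul]
    · have hj : j = 1 ∨ j = 0 := by omega
      rcases hj with rfl | rfl
      · rw [hD' 1 odd_one, mul_zero]
      · rw [hD 0, hD0, mul_zero]
  · intro hn
    exact absurd (Finset.HasAntidiagonal.mem_antidiagonal (n := m + 2).2 rfl) hn

/-- The derivative formula of Jacobi for the product of the three theta constants. -/
theorem jacobi_derivative_formula :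
    genSeries (fun n : ℤ => (2 * n + 1) ^ 2) (fun n => n.negOnePow * (2 * n + 1)) =
      genSeries (fun p : ℤ × ℤ × ℤ => (2 * p.1 + 1) ^ 2 + ((2 * p.2.1) ^ 2 + (2 * p.2.2) ^ 2))
        fun p => p.2.2.negOnePow := by
  have hO := isProperNonneg_odd_sq
  have hE := isProperNonneg_even_sq
  have hO2 := hO.const_mul two_pos
  have hE2 := hE.const_mul two_pos
  have hD : genSeries (fun n : ℤ => (2 * n + 1) ^ 2) 1 *
      (genSeries (fun n : ℤ => (2 * n) ^ 2) 1 *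
        genSeries (fun n : ℤ => (2 * n) ^ 2) fun n => n.negOnePow) =
      genSeries (fun p : ℤ × ℤ × ℤ => (2 * p.1 + 1) ^ 2 + ((2 * p.2.1) ^ 2 + (2 * p.2.2) ^ 2))
        fun p => p.2.2.negOnePow := by
    rw [genSeries_mul hE hE, genSeries_mul hO (hE.add hE)]
    simp
  have hD2 : genSeries (fun n : ℤ => 2 * (2 * n + 1) ^ 2) 1 *
      (genSeries (fun n : ℤ => 2 * (2 * n) ^ 2) 1 *
        genSeries (fun n : ℤ => 2 * (2 * n) ^ 2) fun n => n.negOnePow) =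
      genSeries (fun p : ℤ × ℤ × ℤ =>
        2 * ((2 * p.1 + 1) ^ 2 + ((2 * p.2.1) ^ 2 + (2 * p.2.2) ^ 2)))
        fun p => p.2.2.negOnePow := by
    rw [genSeries_mul hE2 hE2, genSeries_mul hO2 (hE2.add hE2)]
    simp [mul_add]
  have hD0 : coeff 0 (genSeries (fun p : ℤ × ℤ × ℤ =>
      (2 * p.1 + 1) ^ 2 + ((2 * p.2.1) ^ 2 + (2 * p.2.2) ^ 2)) fun p => p.2.2.negOnePow) = 0 := by
    rw [← hD, coeff_mul, Finset.HasAntidiagonal.antidiagonal_zero, Finset.sum_singleton,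
      coeff_zero_odd_theta, zero_mul]
  have hD1 : coeff 1 (genSeries (fun p : ℤ × ℤ × ℤ =>
      (2 * p.1 + 1) ^ 2 + ((2 * p.2.1) ^ 2 + (2 * p.2.2) ^ 2)) fun p => p.2.2.negOnePow) = 2 := by
    rw [← hD, coeff_mul, Finset.Nat.antidiagonal_succ, Finset.sum_cons, coeff_zero_odd_theta,
      zero_mul, zero_add, Finset.HasAntidiagonal.antidiagonal_zero, Finset.map_singleton,
      Finset.sum_singleton]
    simp only [Function.Embedding.coe_prodMap, Prod.map_apply, Function.Embedding.refl_apply,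
      Function.Embedding.coeFn_mk]
    rw [coeff_mul, Finset.HasAntidiagonal.antidiagonal_zero, Finset.sum_singleton,
      coeff_zero_even_theta, coeff_zero_even_theta, coeff_genSeries,
      finsum_odd_sq_eq (j := 0) (by norm_num)]
    simp
  have h1 := odd_theta_sq
  have h2 := theta_deriv_mul_odd_theta
  have h3 := alternating_theta_mul_theta
  rw [← sub_eq_zero]
  refine eq_zero_of_mul_eq_mul (D := genSeries (fun p : ℤ × ℤ × ℤ =>
      (2 * p.1 + 1) ^ 2 + ((2 * p.2.1) ^ 2 + (2 * p.2.2) ^ 2)) fun p => p.2.2.negOnePow)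
    (F₂ := genSeries (fun n : ℤ => 2 * (2 * n + 1) ^ 2) (fun n => n.negOnePow * (2 * n + 1)) -
      genSeries (fun p : ℤ × ℤ × ℤ =>
        2 * ((2 * p.1 + 1) ^ 2 + ((2 * p.2.1) ^ 2 + (2 * p.2.2) ^ 2)))
        fun p => p.2.2.negOnePow)
    (D₂ := genSeries (fun p : ℤ × ℤ × ℤ =>
        2 * ((2 * p.1 + 1) ^ 2 + ((2 * p.2.1) ^ 2 + (2 * p.2.2) ^ 2)))
        fun p => p.2.2.negOnePow) ?_ ?_ ?_ ?_ ?_ ?_ ?_ ?_ ?_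
  · rw [← hD, ← hD2]
    generalize genSeries (fun n : ℤ => (2 * n + 1) ^ 2) 1 = O at *
    generalize genSeries (fun n : ℤ => 2 * (2 * n + 1) ^ 2) 1 = O₂ at *
    generalize genSeries (fun n : ℤ => (2 * n) ^ 2) 1 = B at *
    generalize genSeries (fun n : ℤ => 2 * (2 * n) ^ 2) 1 = B₂ at *
    generalize genSeries (fun n : ℤ => (2 * n) ^ 2) (fun n => n.negOnePow) = A at *
    generalize genSeries (fun n : ℤ => 2 * (2 * n) ^ 2) (fun n => n.negOnePow) = A₂ at *
    generalize genSeries (fun n : ℤ => (2 * n + 1) ^ 2) _ = E at *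
    generalize genSeries (fun n : ℤ => 2 * (2 * n + 1) ^ 2) _ = E₂ at *
    refine mul_left_cancel₀ two_ne_zero_powerSeries ?_
    linear_combination (-E * A₂) * h1 + O * A₂ * h2 - 2 * O * E₂ * h3
  · intro n
    rw [map_sub, map_sub, coeff_genSeries_two_mul, coeff_genSeries_two_mul]
  · intro n hn
    rw [map_sub, coeff_genSeries_two_mul_of_odd _ hn, coeff_genSeries_two_mul_of_odd _ hn,
      sub_zero]
  · exact fun n => coeff_genSeries_two_mul _ n
  · exact fun n hn => coeff_genSeries_two_mul_of_odd _ hn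
  · exact hD0
  · rw [hD1]
    exact two_ne_zero
  · rw [map_sub, hD0, coeff_zero_odd_theta, sub_zero]
  · rw [map_sub, hD1, coeff_genSeries, finsum_odd_sq_eq (j := 0) (by norm_num)]
    simp

end Theta

section Counting

theorem cast_coeff_theta_deriv {k : ℕ} (hk : Odd k) :
    ((coeff k (genSeries (fun n : ℤ => (2 * n + 1) ^ 2) fun n => n.negOnePow * (2 * n + 1)) : ℤ) :
      ℚ) = 2 * sqTerm k := by
  rw [coeff_genSeries, sqTerm]
  split_ifs with h
  · obtain ⟨s, rfl⟩ := h
    obtain ⟨j, rfl⟩ := (Nat.odd_mul.1 hk).1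
    rw [Nat.sqrt_eq, finsum_odd_sq_eq (j := j) (by push_cast; ring), negOnePow_cast_sub]
    have : (2 * j + 1 - 1) / 2 = j := by omega
    rw [this]
    have h2 : (((j : ℤ).negOnePow : ℤˣ) : ℤ) = (-1) ^ j := by
      simp [Int.negOnePow_def]
    rw [h2]
    simp
    ring
  · have : {n : ℤ | (2 * n + 1) ^ 2 = (k : ℤ)} = ∅ := by
      ext n
      simp only [Set.mem_ofPred_eq, Set.mem_empty_iff_false, iff_false]
      intro hn
      refine h ⟨(2 * n + 1).natAbs, ?_⟩
      zify
      rw [← hn, ← sq, sq_abs]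
    rw [this, finsum_mem_empty]
    simp

/-- The integer points on the sphere `x² + y² + z² = m`. -/
def spherePoints (m : ℕ) : Set (ℤ × ℤ × ℤ) :=
  {v | v.1 ^ 2 + v.2.1 ^ 2 + v.2.2 ^ 2 = (m : ℤ)}

theorem r1_eq_ncard (m : ℕ) : r1 m = (spherePoints m).ncard := rfl

theorem spherePoints_finite (m : ℕ) : (spherePoints m).Finite := by
  have h := Set.finite_Icc (-(m : ℤ)) m
  refine (h.prod (h.prod h)).subset ?_
  rintro ⟨x, y, z⟩ hv
  simp only [spherePoints, Set.mem_ofPred_eq] at hv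
  simp only [Set.mem_prod, Set.mem_Icc, ← abs_le]
  have hx := Int.natAbs_le_self_sq x
  have hy := Int.natAbs_le_self_sq y
  have hz := Int.natAbs_le_self_sq z
  simp only [Int.natCast_natAbs] at hx hy hz
  refine ⟨?_, ?_, ?_⟩ <;> nlinarith [sq_nonneg x, sq_nonneg y, sq_nonneg z]

theorem ncard_spherePoints_eq_three_mul {m : ℕ} {R : ℤ → Prop}
    (h1 : ∀ v ∈ spherePoints m, R v.1 ∨ R v.2.1 ∨ R v.2.2)
    (h2 : ∀ v ∈ spherePoints m, ¬ (R v.1 ∧ R v.2.1)) :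
    (spherePoints m).ncard = 3 * {v ∈ spherePoints m | R v.2.2}.ncard := by
  let e : ℤ × ℤ × ℤ ≃ ℤ × ℤ × ℤ :=
    ⟨fun v => (v.2.1, v.2.2, v.1), fun v => (v.2.2, v.1, v.2.1), fun _ => rfl, fun _ => rfl⟩
  have he : ∀ v, e v ∈ spherePoints m ↔ v ∈ spherePoints m := by
    intro v
    simp only [e, spherePoints, Equiv.coe_fn_mk, Set.mem_ofPred_eq]
    constructor <;> intro h <;> linarith
  have hfin := spherePoints_finite m
  have hx : {v ∈ spherePoints m | R v.2.2}.ncard = {v ∈ spherePoints m | R v.1}.ncard := by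
    rw [← Set.ncard_preimage_of_injective_subset_range e.injective
      (by rw [e.surjective.range_eq]; exact Set.subset_univ _)]
    congr 1
    ext v
    simp only [Set.mem_preimage, Set.mem_sep_iff, he]
    rfl
  have hy : {v ∈ spherePoints m | R v.1}.ncard = {v ∈ spherePoints m | R v.2.1}.ncard := by
    rw [← Set.ncard_preimage_of_injective_subset_range e.injective
      (by rw [e.surjective.range_eq]; exact Set.subset_univ _)]
    congr 1
    ext v
    simp only [Set.mem_preimage, Set.mem_sep_iff, he]
    rfl
  have hunion : spherePoints m = {v ∈ spherePoints m | R v.1} ∪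
      ({v ∈ spherePoints m | R v.2.1} ∪ {v ∈ spherePoints m | R v.2.2}) := by
    ext v
    have := h1 v
    simp only [Set.mem_union, Set.mem_sep_iff]
    tauto
  have hyz : ∀ v ∈ spherePoints m, ¬ (R v.2.1 ∧ R v.2.2) := fun v hv =>
    h2 (e v) ((he v).2 hv)
  have hzx : ∀ v ∈ spherePoints m, ¬ (R v.2.2 ∧ R v.1) := fun v hv =>
    hyz (e v) ((he v).2 hv)
  conv_lhs => rw [hunion]
  rw [Set.ncard_union_eq _ (hfin.sep _) ((hfin.sep _).union (hfin.sep _)),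
    Set.ncard_union_eq _ (hfin.sep _) (hfin.sep _), ← hy, ← hx]
  · ring
  · rw [Set.disjoint_left]
    exact fun v hv hv' => hyz v hv.1 ⟨hv.2, hv'.2⟩
  · rw [Set.disjoint_left]
    rintro v hv (hv' | hv')
    · exact h2 v hv.1 ⟨hv.2, hv'.2⟩
    · exact hzx v hv.1 ⟨hv'.2, hv.2⟩

theorem sq_emod_four_cases (x : ℤ) : x % 2 = 0 ∧ x ^ 2 % 4 = 0 ∨ x % 2 = 1 ∧ x ^ 2 % 4 = 1 := by
  rcases Int.even_or_odd' x with ⟨y, rfl | rfl⟩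
  · exact Or.inl ⟨by omega, by ring_nf; omega⟩
  · exact Or.inr ⟨by omega, by ring_nf; omega⟩

theorem ncard_spherePoints_odd {m : ℕ} (hm : m % 4 = 1) :
    (spherePoints m).ncard = 3 * {v ∈ spherePoints m | v.2.2 % 2 = 1}.ncard := by
  refine ncard_spherePoints_eq_three_mul (R := fun x => x % 2 = 1) ?_ ?_ <;>
  · intro v hv
    simp only [spherePoints, Set.mem_ofPred_eq] at hv
    have hx := sq_emod_four_cases v.1
    have hy := sq_emod_four_cases v.2.1
    have hz := sq_emod_four_cases v.2.2
    omega

theorem ncard_spherePoints_even {m : ℕ} (hm : m % 4 = 2) :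
    (spherePoints m).ncard = 3 * {v ∈ spherePoints m | v.2.2 % 2 = 0}.ncard := by
  refine ncard_spherePoints_eq_three_mul (R := fun x => x % 2 = 0) ?_ ?_ <;>
  · intro v hv
    simp only [spherePoints, Set.mem_ofPred_eq] at hv
    have hx := sq_emod_four_cases v.1
    have hy := sq_emod_four_cases v.2.1
    have hz := sq_emod_four_cases v.2.2
    omega

theorem ncard_spherePoints_sep_add_sep (m : ℕ) :
    {v ∈ spherePoints m | v.2.2 % 2 = 0}.ncard + {v ∈ spherePoints m | v.2.2 % 2 = 1}.ncard =
      (spherePoints m).ncard := by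
  rw [← Set.ncard_union_eq _ ((spherePoints_finite m).sep _) ((spherePoints_finite m).sep _)]
  · congr 1
    ext v
    have := Int.emod_two_eq_zero_or_one v.2.2
    simp only [Set.mem_union, Set.mem_sep_iff]
    tauto
  · rw [Set.disjoint_left]
    rintro v ⟨_, h⟩ ⟨_, h'⟩
    omega

theorem ncard_spherePoints_four_mul (m : ℕ) :
    (spherePoints (4 * m)).ncard = (spherePoints m).ncard := by
  have he : Function.Injective fun v : ℤ × ℤ × ℤ => (2 * v.1, 2 * v.2.1, 2 * v.2.2) := by
    rintro ⟨a, b, c⟩ ⟨a', b', c'⟩ h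
    simp only [Prod.mk.injEq] at h ⊢
    omega
  rw [← Set.ncard_preimage_of_injective_subset_range he]
  · congr 1
    ext v
    simp only [spherePoints, Set.mem_preimage, Set.mem_ofPred_eq, Nat.cast_mul, Nat.cast_ofNat]
    constructor <;> intro h <;> linarith
  · rintro ⟨x, y, z⟩ hv
    simp only [spherePoints, Set.mem_ofPred_eq] at hv
    have hx := sq_emod_four_cases x
    have hy := sq_emod_four_cases y
    have hz := sq_emod_four_cases z
    refine ⟨(x / 2, y / 2, z / 2), ?_⟩
    simp only [Prod.mk.injEq]
    omega

theorem card_diagonal_form_four_mul (m : ℕ) :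
    Nat.card {v : ℤ × ℤ × ℤ // v.1 ^ 2 + 4 * v.2.1 ^ 2 + 16 * v.2.2 ^ 2 = ((4 * m : ℕ) : ℤ)} =
      {v ∈ spherePoints m | v.2.2 % 2 = 0}.ncard := by
  have he : Function.Injective fun v : ℤ × ℤ × ℤ => (2 * v.1, v.2.1, v.2.2) := by
    rintro ⟨a, b, c⟩ ⟨a', b', c'⟩ h
    simp only [Prod.mk.injEq] at h ⊢
    omega
  have he' : Function.Injective fun v : ℤ × ℤ × ℤ => (v.1, v.2.1, 2 * v.2.2) := by
    rintro ⟨a, b, c⟩ ⟨a', b', c'⟩ h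
    simp only [Prod.mk.injEq] at h ⊢
    omega
  change {v : ℤ × ℤ × ℤ | v.1 ^ 2 + 4 * v.2.1 ^ 2 + 16 * v.2.2 ^ 2 = ((4 * m : ℕ) : ℤ)}.ncard = _
  rw [← Set.ncard_preimage_of_injective_subset_range he,
    ← Set.ncard_preimage_of_injective_subset_range he' (s := {v ∈ spherePoints m | _})]
  · congr 1
    ext v
    simp only [spherePoints, Set.mem_preimage, Set.mem_ofPred_eq, Nat.cast_mul, Nat.cast_ofNat,
      Int.mul_emod_right, and_true]
    constructor <;> intro h <;> linarith
  · rintro ⟨x, y, z⟩ hv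
    exact ⟨(x, y, z / 2), by simpa using Int.mul_ediv_cancel' (Int.dvd_of_emod_eq_zero hv.2)⟩
  · rintro ⟨x, y, z⟩ hv
    simp only [Set.mem_ofPred_eq] at hv
    have hx := sq_emod_four_cases x
    refine ⟨(x / 2, y, z), ?_⟩
    simp only [Prod.mk.injEq, and_true]
    omega

theorem card_diagonal_form_of_emod_four {k : ℕ} (hk : k % 4 = 1) :
    (Nat.card {v : ℤ × ℤ × ℤ // v.1 ^ 2 + 4 * v.2.1 ^ 2 + 16 * v.2.2 ^ 2 = (k : ℤ)} : ℚ) =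
      1 / 6 * r1 k + sqTerm k := by
  classical
  have hprop := isProperNonneg_odd_sq.add (isProperNonneg_even_sq.add isProperNonneg_even_sq)
  have hfin := hprop.fiber_finite k
  set P := {p : ℤ × ℤ × ℤ | (2 * p.1 + 1) ^ 2 + ((2 * p.2.1) ^ 2 + (2 * p.2.2) ^ 2) = (k : ℤ)}
    with hP
  have hr : r1 k = 3 * P.ncard := by
    have he : Function.Injective fun v : ℤ × ℤ × ℤ => (2 * v.2.1, 2 * v.2.2, 2 * v.1 + 1) := by
      rintro ⟨a, b, c⟩ ⟨a', b', c'⟩ h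
      simp only [Prod.mk.injEq] at h ⊢
      omega
    rw [r1_eq_ncard, ncard_spherePoints_odd hk, ← Set.ncard_preimage_of_injective_subset_range he]
    · congr 2
      ext v
      have : (2 * v.1 + 1) % 2 = 1 := by omega
      simp only [spherePoints, Set.mem_preimage, Set.mem_ofPred_eq, hP, this, and_true]
      constructor <;> intro h <;> linarith
    · rintro ⟨x, y, z⟩ ⟨hv, hz1⟩
      simp only [spherePoints, Set.mem_ofPred_eq] at hv hz1
      have hx := sq_emod_four_cases x
      have hy := sq_emod_four_cases y
      have hz := sq_emod_four_cases z
      refine ⟨(z / 2, x / 2, y / 2), ?_⟩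
      simp only [Prod.mk.injEq]
      omega
  have hN : Nat.card {v : ℤ × ℤ × ℤ // v.1 ^ 2 + 4 * v.2.1 ^ 2 + 16 * v.2.2 ^ 2 = (k : ℤ)} =
      {p ∈ P | Even p.2.2}.ncard := by
    have he : Function.Injective fun v : ℤ × ℤ × ℤ => (2 * v.1 + 1, v.2.1, v.2.2) := by
      rintro ⟨a, b, c⟩ ⟨a', b', c'⟩ h
      simp only [Prod.mk.injEq] at h ⊢
      omega
    have he' : Function.Injective fun v : ℤ × ℤ × ℤ => (v.1, v.2.1, 2 * v.2.2) := by
      rintro ⟨a, b, c⟩ ⟨a', b', c'⟩ h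
      simp only [Prod.mk.injEq] at h ⊢
      omega
    change {v : ℤ × ℤ × ℤ | v.1 ^ 2 + 4 * v.2.1 ^ 2 + 16 * v.2.2 ^ 2 = (k : ℤ)}.ncard = _
    rw [← Set.ncard_preimage_of_injective_subset_range he,
      ← Set.ncard_preimage_of_injective_subset_range he' (s := {p ∈ P | _})]
    · congr 1
      ext v
      simp only [hP, Set.mem_preimage, Set.mem_ofPred_eq, even_two_mul, and_true]
      constructor <;> intro h <;> linarith
    · rintro ⟨x, y, z⟩ hv
      exact ⟨(x, y, z / 2), by simpa using Int.two_mul_ediv_two_of_even hv.2⟩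
    · rintro ⟨x, y, z⟩ hv
      simp only [Set.mem_ofPred_eq] at hv
      have hx := sq_emod_four_cases x
      refine ⟨(x / 2, y, z), ?_⟩
      simp only [Prod.mk.injEq, and_true]
      omega
  have hT : ((∑ p ∈ hfin.toFinset, (p.2.2.negOnePow : ℤˣ) : ℤ) : ℚ) = 2 * sqTerm k := by
    rw [← cast_coeff_theta_deriv (Nat.odd_iff.2 (by omega)), jacobi_derivative_formula,
      coeff_genSeries, finsum_mem_eq_finite_toFinset_sum _ hfin]
  have hsum : (P.ncard : ℤ) + ∑ p ∈ hfin.toFinset, ((p.2.2.negOnePow : ℤˣ) : ℤ) =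
      2 * {p ∈ P | Even p.2.2}.ncard := by
    have hcard : {p ∈ P | Even p.2.2}.ncard = (hfin.toFinset.filter fun p => Even p.2.2).card := by
      rw [← Set.ncard_coe_finset]
      congr 1
      ext p
      simp
    rw [hcard, Set.ncard_eq_toFinset_card P hfin, Finset.card_filter, Finset.card_eq_sum_ones]
    push_cast
    rw [← Finset.sum_add_distrib, Finset.mul_sum]
    refine Finset.sum_congr rfl fun p _ => ?_
    split_ifs with h
    · rw [Int.negOnePow_even _ h]; rfl
    · rw [Int.negOnePow_odd _ (Int.not_even_iff_odd.1 h)]; rfl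
  have hsum' := congrArg (Int.cast : ℤ → ℚ) hsum
  rw [Int.cast_add, hT] at hsum'
  push_cast at hsum'
  rw [hN, hr]
  push_cast
  linarith

theorem sqTerm_eq_zero_of_mod_eight {k : ℕ} (hk : k % 8 = 5) : sqTerm k = 0 := by
  refine if_neg ?_
  rintro ⟨s, rfl⟩
  have : s % 8 < 8 := Nat.mod_lt _ (by norm_num)
  rw [Nat.mul_mod] at hk
  interval_cases s % 8 <;> omega

theorem card_diagonal_form_eq_zero {k : ℕ} (hk : k % 4 = 2 ∨ k % 4 = 3) :
    Nat.card {v : ℤ × ℤ × ℤ // v.1 ^ 2 + 4 * v.2.1 ^ 2 + 16 * v.2.2 ^ 2 = (k : ℤ)} = 0 := by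
  refine @Nat.card_of_isEmpty _ ⟨?_⟩
  rintro ⟨⟨x, y, z⟩, hv⟩
  simp only at hv
  have hx := sq_emod_four_cases x
  omega

end Counting

end

theorem stmt_1 (a t α : ℕ) (hα : α = 1 ∨ α = 3 ∨ α = 5 ∨ α = 7)
    (k : ℕ) (hk : k = 2 ^ a * (8 * t + α)) :
    (Nat.card {v : ℤ × ℤ × ℤ // v.1 ^ 2 + 4 * v.2.1 ^ 2 + 16 * v.2.2 ^ 2 = (k : ℤ)} : ℚ) =
      if a = 0 ∧ α = 1 then (1 / 6 : ℚ) * r1 k + sqTerm k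
      else if a = 0 ∧ α = 5 then (1 / 6 : ℚ) * r1 k
      else if (a = 2 ∧ α = 1) ∨ (a = 2 ∧ α = 5) then (2 / 3 : ℚ) * r1 k
      else if a = 3 then (1 / 3 : ℚ) * r1 k
      else if 4 ≤ a then (r1 k : ℚ)
      else 0 := by
  have hcases : a = 0 ∨ a = 1 ∨ a = 2 ∨ a = 3 ∨ 4 ≤ a := by omega
  rcases hcases with rfl | rfl | rfl | rfl | ha
  · rw [pow_zero, one_mul] at hk
    rcases hα with rfl | rfl | rfl | rfl
    · simpa using card_diagonal_form_of_emod_four (k := k) (by omega)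
    · simpa using card_diagonal_form_eq_zero (k := k) (by omega)
    · have h := card_diagonal_form_of_emod_four (k := k) (by omega)
      rw [sqTerm_eq_zero_of_mod_eight (by omega), add_zero] at h
      simpa using h
    · simpa using card_diagonal_form_eq_zero (k := k) (by omega)
  · simpa using card_diagonal_form_eq_zero (k := k) (by omega)
  · obtain ⟨m, hm⟩ : ∃ m, m = 8 * t + α := ⟨_, rfl⟩
    rw [← hm, show 2 ^ 2 = 4 by norm_num] at hk
    subst hk
    rw [card_diagonal_form_four_mul, r1_eq_ncard, ncard_spherePoints_four_mul]
    by_cases h : α = 1 ∨ α = 5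
    · have h1 := ncard_spherePoints_odd (m := m) (by omega)
      have h2 := ncard_spherePoints_sep_add_sep m
      have h3 : 3 * ({v ∈ spherePoints m | v.2.2 % 2 = 0}.ncard : ℚ) =
          2 * (spherePoints m).ncard := by
        norm_cast
        omega
      rw [if_neg (by omega), if_neg (by omega), if_pos (by omega)]
      linarith
    · rw [if_neg (by omega), if_neg (by omega), if_neg (by omega), if_neg (by omega),
        if_neg (by omega), Nat.cast_eq_zero, Set.ncard_eq_zero ((spherePoints_finite m).sep _)]
      ext v
      simp only [spherePoints, Set.mem_ofPred_eq, Set.mem_empty_iff_false, iff_false]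
      have hx := sq_emod_four_cases v.1
      have hy := sq_emod_four_cases v.2.1
      have hz := sq_emod_four_cases v.2.2
      omega
  · obtain ⟨m, hm⟩ : ∃ m, m = 2 * (8 * t + α) := ⟨_, rfl⟩
    obtain rfl : k = 4 * m := by omega
    have h1 := ncard_spherePoints_even (m := m) (by omega)
    rw [card_diagonal_form_four_mul, r1_eq_ncard, ncard_spherePoints_four_mul, h1]
    simp
  · obtain ⟨b, rfl⟩ := Nat.exists_eq_add_of_le ha
    obtain ⟨m, hm⟩ : ∃ m, m = 4 * (2 ^ b * (8 * t + α)) := ⟨_, rfl⟩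
    obtain rfl : k = 4 * m := by rw [hk, hm]; ring
    rw [card_diagonal_form_four_mul, r1_eq_ncard, ncard_spherePoints_four_mul, if_neg (by omega),
      if_neg (by omega), if_neg (by omega), if_neg (by omega), if_pos (by omega)]
    congr 2
    ext v
    simp only [spherePoints, Set.mem_ofPred_eq, and_iff_left_iff_imp]
    intro hv
    have hx := sq_emod_four_cases v.1
    have hy := sq_emod_four_cases v.2.1
    have hz := sq_emod_four_cases v.2.2
    omega
end

section
/- Let k be a positive integer written uniquely as k = 2^a(8t+α) with a,t nonnegative integers and α ∈ {1,3,5,7}. Then the number of (x,y,z) ∈ ℤ³ with x²+8y²+64z² = k equals: (1/4)𝔯₂(k) + δ_□(k)·(−1)^((√k−1)/2)·(−1)^((k−1)/8)·√k if (a,α) = (0,1); (1/6)𝔯₂(k) if (a,α) ∈ {(2,1),(2,3)} or a = 4 (with any α); (1/3)𝔯₂(k) if (a,α) ∈ {(3,1),(5,1),(5,5)} or a = 6 (with any α); (1/2)𝔯₂(k) if (a,α) = (3,3); 𝔯₂(k) if (a,α) = (5,3) or a ≥ 7; and 0 in all remaining cases. -/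
/-- The number of representations of `k` by `x² + y² + 2z²`. -/
noncomputable def r2 (k : ℕ) : ℕ :=
  Nat.card {v : ℤ × ℤ × ℤ // v.1 ^ 2 + v.2.1 ^ 2 + 2 * v.2.2 ^ 2 = (k : ℤ)}

/-- `δ_□(k) · (−1)^((√k−1)/2) · (−1)^((k−1)/8) · √k`, as a rational number. -/
noncomputable def sqTerm2 (k : ℕ) : ℚ :=
  if IsSquare k then
    (-1 : ℚ) ^ ((Nat.sqrt k - 1) / 2) * (-1 : ℚ) ^ ((k - 1) / 8) * (Nat.sqrt k : ℚ)
  else 0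


open PowerSeries

/-- The generating series `∑ i, w i * X ^ d i` of a weighted family with integer degrees. -/
noncomputable def thetaSeries {ι : Type*} (d w : ι → ℤ) : ℤ⟦X⟧ :=
  PowerSeries.mk fun n => ∑ᶠ i ∈ {i | d i = (n : ℤ)}, w i

/-- A degree function is proper if it is nonnegative with finite sublevel sets. -/
def ProperDegree {ι : Type*} (d : ι → ℤ) : Prop :=
  (∀ i, 0 ≤ d i) ∧ ∀ n : ℤ, {i | d i ≤ n}.Finite

section Theta

variable {ι κ : Type*} {d w : ι → ℤ} {e v : κ → ℤ}

lemma coeff_thetaSeries (d w : ι → ℤ) (n : ℕ) :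
    coeff n (thetaSeries d w) = ∑ᶠ i ∈ {i | d i = (n : ℤ)}, w i :=
  coeff_mk _ _

lemma ProperDegree.finite_fiber (hd : ProperDegree d) (n : ℤ) : {i | d i = n}.Finite :=
  (hd.2 n).subset fun _ hi => le_of_eq hi

lemma ProperDegree.comp (hd : ProperDegree d) {f : κ → ι} (hf : f.Injective) :
    ProperDegree fun j => d (f j) :=
  ⟨fun j => hd.1 (f j), fun n =>
    Set.Finite.preimage (s := {i | d i ≤ n}) hf.injOn (hd.2 n)⟩

lemma ProperDegree.add (hd : ProperDegree d) (he : ProperDegree e) :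
    ProperDegree fun i : ι × κ => d i.1 + e i.2 := by
  refine ⟨fun i => add_nonneg (hd.1 _) (he.1 _), fun n => ?_⟩
  refine ((hd.2 n).prod (he.2 n)).subset fun i hi => ?_
  have h1 := hd.1 i.1
  have h2 := he.1 i.2
  simp only [Set.mem_ofPred_eq, Set.mem_prod] at hi ⊢
  constructor <;> linarith

lemma properDegree_mul_sq {c : ℤ} (hc : 0 < c) : ProperDegree fun x : ℤ => c * x ^ 2 := by
  refine ⟨fun x => by positivity, fun n => ?_⟩
  refine (Set.finite_Icc (-n) n).subset fun x hx => ?_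
  simp only [Set.mem_ofPred_eq, Set.mem_Icc] at hx ⊢
  have : |x| ≤ x ^ 2 := by
    rw [← sq_abs]
    rcases eq_or_lt_of_le (abs_nonneg x) with h | h
    · rw [← h]; simp
    · nlinarith
  exact abs_le.mp (by nlinarith [sq_nonneg x])

lemma thetaSeries_mul (hd : ProperDegree d) (he : ProperDegree e) :
    thetaSeries d w * thetaSeries e v =
      thetaSeries (fun i : ι × κ => d i.1 + e i.2) fun i => w i.1 * v i.2 := by
  classical
  ext n
  rw [coeff_mul, coeff_thetaSeries,
    finsum_mem_eq_finite_toFinset_sum _ ((hd.add he).finite_fiber n)]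
  refine Eq.trans ?_ (Finset.sum_fiberwise_of_maps_to (t := Finset.HasAntidiagonal.antidiagonal n)
    (g := fun i : ι × κ => ((d i.1).toNat, (e i.2).toNat)) ?_ _)
  · refine Finset.sum_congr rfl fun ab hab => ?_
    rw [coeff_thetaSeries, coeff_thetaSeries,
      finsum_mem_eq_finite_toFinset_sum _ (hd.finite_fiber _),
      finsum_mem_eq_finite_toFinset_sum _ (he.finite_fiber _), Finset.sum_mul_sum,
      ← Finset.sum_product']
    refine Finset.sum_congr ?_ fun _ _ => rfl
    ext i
    have h1 := hd.1 i.1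
    have h2 := he.1 i.2
    simp only [Finset.HasAntidiagonal.mem_antidiagonal] at hab
    simp only [Finset.mem_product, Set.Finite.mem_toFinset, Set.mem_ofPred_eq, Finset.mem_filter,
      Prod.ext_iff]
    omega
  · intro i hi
    have h1 := hd.1 i.1
    have h2 := he.1 i.2
    simp only [Set.Finite.mem_toFinset, Set.mem_ofPred_eq,
      Finset.HasAntidiagonal.mem_antidiagonal] at hi ⊢
    omega

lemma X_mul_derivative_thetaSeries (d w : ι → ℤ) :
    X * d⁄dX ℤ (thetaSeries d w) = thetaSeries d fun i => d i * w i := by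
  ext n
  have key : coeff n (thetaSeries d fun i => d i * w i) = n * coeff n (thetaSeries d w) := by
    rw [coeff_thetaSeries, coeff_thetaSeries, mul_finsum_mem]
    exact finsum_mem_congr rfl fun i hi => by rw [Set.mem_ofPred_eq.mp hi]
  rw [key]
  cases n with
  | zero => simp
  | succ n => rw [coeff_succ_X_mul, coeff_derivative]; push_cast; ring

lemma thetaSeries_add (hd : ProperDegree d) (w w' : ι → ℤ) :
    thetaSeries d (fun i => w i + w' i) = thetaSeries d w + thetaSeries d w' := by
  ext n
  simp only [map_add, coeff_thetaSeries]
  exact finsum_mem_add_distrib (hd.finite_fiber _)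

lemma thetaSeries_const_mul (c : ℤ) (d w : ι → ℤ) :
    thetaSeries d (fun i => c * w i) = (c : ℤ⟦X⟧) * thetaSeries d w := by
  ext n
  rw [← map_intCast (C (R := ℤ)), coeff_C_mul, coeff_thetaSeries, coeff_thetaSeries, Int.cast_id,
    mul_finsum_mem]

lemma thetaSeries_comp_equiv (σ : ι ≃ ι) (hσ : ∀ i, d (σ i) = d i) :
    thetaSeries d (fun i => w (σ i)) = thetaSeries d w := by
  ext n
  rw [coeff_thetaSeries, coeff_thetaSeries]
  refine finsum_mem_eq_of_bijOn σ ⟨fun i hi => ?_, σ.injective.injOn, fun i hi => ?_⟩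
    fun _ _ => rfl
  · simpa [hσ] using hi
  · exact ⟨σ.symm i, by simpa [← hσ (σ.symm i)] using hi, by simp⟩

/-- Splitting a theta series along two injections whose ranges partition the index set. -/
lemma thetaSeries_split (hd : ProperDegree d) {f g : κ → ι} (hf : f.Injective) (hg : g.Injective)
    (hfg : ∀ i j, f i ≠ g j) (hcover : ∀ i, (∃ j, f j = i) ∨ ∃ j, g j = i) :
    thetaSeries d w = thetaSeries (fun j => d (f j)) (fun j => w (f j)) +
      thetaSeries (fun j => d (g j)) (fun j => w (g j)) := by
  ext n
  simp only [map_add, coeff_thetaSeries]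
  rw [← finsum_mem_image (f := w) (g := f) hf.injOn, ← finsum_mem_image (f := w) (g := g) hg.injOn,
    ← finsum_mem_union]
  · refine finsum_mem_congr (Set.ext fun i => ⟨fun hi => ?_, ?_⟩) fun _ _ => rfl
    · rcases hcover i with ⟨j, rfl⟩ | ⟨j, rfl⟩
      · exact Or.inl ⟨j, hi, rfl⟩
      · exact Or.inr ⟨j, hi, rfl⟩
    · rintro (⟨j, hj, rfl⟩ | ⟨j, hj, rfl⟩) <;> exact hj
  · rw [Set.disjoint_left]
    rintro _ ⟨j, -, rfl⟩ ⟨j', -, h⟩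
    exact hfg j j' h.symm
  · exact ((hd.comp hf).finite_fiber n).image f
  · exact ((hd.comp hg).finite_fiber n).image g

end Theta

section ThetaIdentities

instance : CharZero ℤ⟦X⟧ := charZero_of_injective_ringHom PowerSeries.C_injective

/-- `∑ w j * X ^ (4 j + 1) ^ 2`, a sum over one representative of each pair `±n` of odd integers. -/
noncomputable def oddTheta (w : ℤ → ℤ) : ℤ⟦X⟧ :=
  thetaSeries (fun j : ℤ => (4 * j + 1) ^ 2) w

/-- `∑ w p * X ^ (2 (2 p + 1) ^ 2)`. -/
noncomputable def doubleOddTheta (w : ℤ → ℤ) : ℤ⟦X⟧ :=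
  thetaSeries (fun p : ℤ => 2 * (2 * p + 1) ^ 2) w

/-- `∑ w x * X ^ (c x ^ 2)`. -/
noncomputable def sqTheta (c : ℤ) (w : ℤ → ℤ) : ℤ⟦X⟧ :=
  thetaSeries (fun x : ℤ => c * x ^ 2) w

lemma properDegree_odd : ProperDegree fun j : ℤ => (4 * j + 1) ^ 2 := by
  simpa using (properDegree_mul_sq one_pos).comp (f := fun j : ℤ => 4 * j + 1)
    fun a b h => by simpa using h

lemma properDegree_doubleOdd : ProperDegree fun p : ℤ => 2 * (2 * p + 1) ^ 2 :=
  (properDegree_mul_sq two_pos).comp (f := fun p : ℤ => 2 * p + 1) fun a b h => by simpa using h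

/-- Rotation of the lattice of pairs of odd integers by an eighth of a turn. -/
lemma thetaSeries_rotate (W : ℤ × ℤ → ℤ) (hW : ∀ p d, W (-1 - p, d) = W (p, d)) :
    thetaSeries (fun i : ℤ × ℤ => 2 * (2 * i.1 + 1) ^ 2 + 8 * i.2 ^ 2) W =
      2 * thetaSeries (fun i : ℤ × ℤ => (4 * i.1 + 1) ^ 2 + (4 * i.2 + 1) ^ 2)
        fun i => W (i.1 + i.2, i.1 - i.2) := by
  have hd : ProperDegree fun i : ℤ × ℤ => 2 * (2 * i.1 + 1) ^ 2 + 8 * i.2 ^ 2 :=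
    properDegree_doubleOdd.add (properDegree_mul_sq (by norm_num))
  rw [thetaSeries_split hd (f := fun i : ℤ × ℤ => (i.1 + i.2, i.1 - i.2))
    (g := fun i : ℤ × ℤ => (-1 - (i.1 + i.2), i.1 - i.2)), two_mul]
  · congr 2
    · funext i; ring
    · funext i; ring
    · funext i; exact hW _ _
  · rintro ⟨a, b⟩ ⟨c, d⟩ h
    simp only [Prod.mk.injEq] at h ⊢
    omega
  · rintro ⟨a, b⟩ ⟨c, d⟩ h
    simp only [Prod.mk.injEq] at h ⊢
    omega
  · rintro ⟨a, b⟩ ⟨c, d⟩ h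
    simp only [Prod.mk.injEq] at h
    omega
  · rintro ⟨p, d⟩
    rcases Int.even_or_odd (p + d) with ⟨e, he⟩ | ⟨e, he⟩
    · exact Or.inl ⟨(e, p - e), by ext <;> simp only <;> omega⟩
    · exact Or.inr ⟨(d - e - 1, -e - 1), by ext <;> simp only <;> omega⟩

lemma oddTheta_mul (w v : ℤ → ℤ) :
    oddTheta w * oddTheta v =
      thetaSeries (fun i : ℤ × ℤ => (4 * i.1 + 1) ^ 2 + (4 * i.2 + 1) ^ 2)
        fun i => w i.1 * v i.2 :=
  thetaSeries_mul properDegree_odd properDegree_odd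

lemma doubleOddTheta_mul (w v : ℤ → ℤ) :
    doubleOddTheta w * sqTheta 8 v =
      thetaSeries (fun i : ℤ × ℤ => 2 * (2 * i.1 + 1) ^ 2 + 8 * i.2 ^ 2)
        fun i => w i.1 * v i.2 :=
  thetaSeries_mul properDegree_doubleOdd (properDegree_mul_sq (by norm_num))

lemma negOnePow_neg_one_sub (n : ℤ) : ((-1 - n).negOnePow : ℤ) = -n.negOnePow := by
  rw [Int.negOnePow_sub]; simp

lemma negOnePow_add_val (m n : ℤ) :
    ((m + n).negOnePow : ℤ) = m.negOnePow * n.negOnePow := by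
  rw [Int.negOnePow_add, Units.val_mul]

lemma negOnePow_sub_val (m n : ℤ) :
    ((m - n).negOnePow : ℤ) = m.negOnePow * n.negOnePow := by
  rw [Int.negOnePow_sub, Units.val_mul]

lemma two_mul_oddTheta_one_sq :
    2 * (oddTheta 1) ^ 2 = doubleOddTheta 1 * sqTheta 8 1 := by
  rw [sq, oddTheta_mul, doubleOddTheta_mul, thetaSeries_rotate _ fun p d => rfl]
  rfl

lemma two_mul_oddTheta_sign_sq :
    2 * (oddTheta fun j => j.negOnePow) ^ 2 =
      doubleOddTheta 1 * sqTheta 8 fun x => x.negOnePow := by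
  rw [sq, oddTheta_mul, doubleOddTheta_mul, thetaSeries_rotate _ fun p d => rfl]
  simp [negOnePow_sub_val]

lemma two_mul_oddTheta_mul_sign :
    2 * (oddTheta (fun j => j.negOnePow * (4 * j + 1)) * oddTheta fun j => j.negOnePow) =
      doubleOddTheta (fun p => p.negOnePow * (2 * p + 1)) * sqTheta 8 1 := by
  have h := thetaSeries_add (properDegree_odd.add properDegree_odd)
    (fun i : ℤ × ℤ => (i.1.negOnePow * (4 * i.1 + 1)) * (i.2.negOnePow : ℤ))
    (fun i : ℤ × ℤ => (i.1.negOnePow : ℤ) * (i.2.negOnePow * (4 * i.2 + 1)))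
  rw [← oddTheta_mul (fun j => j.negOnePow * (4 * j + 1)) fun j => j.negOnePow,
    ← oddTheta_mul (fun j => j.negOnePow) fun j => j.negOnePow * (4 * j + 1)] at h
  have h2 : (2 : ℤ⟦X⟧) * (doubleOddTheta (fun p => p.negOnePow * (2 * p + 1)) * sqTheta 8 1) =
      2 * thetaSeries (fun i : ℤ × ℤ => (4 * i.1 + 1) ^ 2 + (4 * i.2 + 1) ^ 2) fun i =>
        (i.1.negOnePow * (4 * i.1 + 1)) * (i.2.negOnePow : ℤ) +
          (i.1.negOnePow : ℤ) * (i.2.negOnePow * (4 * i.2 + 1)) := by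
    rw [doubleOddTheta_mul]
    have := thetaSeries_const_mul 2 (fun i : ℤ × ℤ => 2 * (2 * i.1 + 1) ^ 2 + 8 * i.2 ^ 2)
      fun i => i.1.negOnePow * (2 * i.1 + 1) * (1 : ℤ → ℤ) i.2
    push_cast at this
    rw [← this, thetaSeries_rotate]
    · congr 2
      funext i
      simp only [negOnePow_add_val, Pi.one_apply]
      ring
    · intro p d
      simp only [negOnePow_neg_one_sub]
      ring
  have h0 : (2 : ℤ⟦X⟧) ≠ 0 := by norm_num
  apply mul_left_cancel₀ h0
  rw [h2, h]
  ring

lemma oddTheta_wronskian :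
    X * d⁄dX ℤ (oddTheta fun j => j.negOnePow * (4 * j + 1)) * (oddTheta fun j => j.negOnePow) -
      (oddTheta fun j => j.negOnePow * (4 * j + 1)) *
        (X * d⁄dX ℤ (oddTheta fun j => j.negOnePow)) =
      doubleOddTheta (fun p => p.negOnePow * (2 * p + 1)) * (X * d⁄dX ℤ (sqTheta 8 1)) := by
  set A := oddTheta fun j => j.negOnePow * (4 * j + 1) with hA
  set B := oddTheta fun j => j.negOnePow with hB
  have hDA : X * d⁄dX ℤ A = oddTheta fun j => (4 * j + 1) ^ 2 * (j.negOnePow * (4 * j + 1)) :=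
    X_mul_derivative_thetaSeries _ _
  have hDB : X * d⁄dX ℤ B = oddTheta fun j => (4 * j + 1) ^ 2 * j.negOnePow :=
    X_mul_derivative_thetaSeries _ _
  have hDF : X * d⁄dX ℤ (sqTheta 8 1) = sqTheta 8 fun x => 8 * x ^ 2 * 1 :=
    X_mul_derivative_thetaSeries _ _
  rw [hDF]
  have hP := properDegree_odd.add properDegree_odd
  have hsum : X * d⁄dX ℤ A * B + B * (X * d⁄dX ℤ A) =
      (A * (X * d⁄dX ℤ B) + (X * d⁄dX ℤ B) * A) +
        thetaSeries (fun i : ℤ × ℤ => (4 * i.1 + 1) ^ 2 + (4 * i.2 + 1) ^ 2) fun i =>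
          32 * ((i.1 + i.2).negOnePow * (2 * (i.1 + i.2) + 1) * (i.1 - i.2) ^ 2) := by
    rw [hDA, hDB, hA, hB]
    simp only [oddTheta_mul]
    rw [← thetaSeries_add hP, ← thetaSeries_add hP, ← thetaSeries_add hP]
    congr 1
    funext i
    simp only [negOnePow_add_val]
    ring
  have h2 : (4 : ℤ⟦X⟧) * (doubleOddTheta (fun p => p.negOnePow * (2 * p + 1)) *
        sqTheta 8 fun x => 8 * x ^ 2 * 1) =
      2 * thetaSeries (fun i : ℤ × ℤ => (4 * i.1 + 1) ^ 2 + (4 * i.2 + 1) ^ 2) fun i =>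
          32 * ((i.1 + i.2).negOnePow * (2 * (i.1 + i.2) + 1) * (i.1 - i.2) ^ 2) := by
    rw [doubleOddTheta_mul]
    have := thetaSeries_const_mul 4 (fun i : ℤ × ℤ => 2 * (2 * i.1 + 1) ^ 2 + 8 * i.2 ^ 2)
      fun i => i.1.negOnePow * (2 * i.1 + 1) * (8 * i.2 ^ 2 * 1)
    push_cast at this
    rw [← this, thetaSeries_rotate]
    · congr 2
      funext i
      simp only
      ring
    · intro p d
      simp only [negOnePow_neg_one_sub]
      ring
  have h0 : (4 : ℤ⟦X⟧) ≠ 0 := by norm_num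
  apply mul_left_cancel₀ h0
  rw [h2]
  linear_combination 2 * hsum

lemma sqTheta_sixteen_sq :
    (sqTheta 16 fun x => x.negOnePow) ^ 2 = sqTheta 8 1 * sqTheta 8 fun x => x.negOnePow := by
  have h8 : ProperDegree fun x : ℤ => 8 * x ^ 2 := properDegree_mul_sq (by norm_num)
  have h16 : ProperDegree fun x : ℤ => 16 * x ^ 2 := properDegree_mul_sq (by norm_num)
  rw [sq, sqTheta, sqTheta, sqTheta, thetaSeries_mul h8 h8, thetaSeries_mul h16 h16,
    thetaSeries_split (h8.add h8) (f := fun i : ℤ × ℤ => (i.1 + i.2, i.1 - i.2))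
    (g := fun i : ℤ × ℤ => (i.1 + i.2 + 1, i.1 - i.2))]
  · set T := thetaSeries (fun j : ℤ × ℤ => 8 * (j.1 + j.2 + 1) ^ 2 + 8 * (j.1 - j.2) ^ 2)
      fun j => (1 : ℤ → ℤ) (j.1 + j.2 + 1) * ((j.1 - j.2).negOnePow : ℤ) with hT
    have hT0 : T = 0 := by
      have := thetaSeries_comp_equiv
        (d := fun j : ℤ × ℤ => 8 * (j.1 + j.2 + 1) ^ 2 + 8 * (j.1 - j.2) ^ 2)
        (w := fun j => (1 : ℤ → ℤ) (j.1 + j.2 + 1) * ((j.1 - j.2).negOnePow : ℤ))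
        ((Equiv.refl ℤ).prodCongr (Equiv.subLeft (-1))) (fun j => by
          simp only [Equiv.prodCongr_apply, Prod.map, Equiv.refl_apply, Equiv.subLeft_apply]
          ring)
      rw [← hT] at this
      have hneg := thetaSeries_const_mul (-1)
        (fun j : ℤ × ℤ => 8 * (j.1 + j.2 + 1) ^ 2 + 8 * (j.1 - j.2) ^ 2)
        (fun j => (1 : ℤ → ℤ) (j.1 + j.2 + 1) * ((j.1 - j.2).negOnePow : ℤ))
      rw [← hT] at hneg
      have h3 : T = ((-1 : ℤ) : ℤ⟦X⟧) * T := by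
        rw [← hneg, ← this]
        congr 1
        funext j
        simp only [Equiv.prodCongr_apply, Prod.map, Equiv.refl_apply, Equiv.subLeft_apply,
          negOnePow_sub_val, Pi.one_apply, Int.negOnePow_neg,
          Int.negOnePow_one, Units.val_neg, Units.val_one]
        ring
      have h4 : (2 : ℤ⟦X⟧) * T = 0 := by
        push_cast at h3
        linear_combination h3
      exact (mul_eq_zero.mp h4).resolve_left (by norm_num)
    rw [hT0, add_zero]
    congr 1
    · funext i; ring
    · funext i; simp [negOnePow_sub_val]
  · rintro ⟨a, b⟩ ⟨c, d⟩ h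
    simp only [Prod.mk.injEq] at h ⊢
    omega
  · rintro ⟨a, b⟩ ⟨c, d⟩ h
    simp only [Prod.mk.injEq] at h ⊢
    omega
  · rintro ⟨a, b⟩ ⟨c, d⟩ h
    simp only [Prod.mk.injEq] at h
    omega
  · rintro ⟨p, d⟩
    rcases Int.even_or_odd (p + d) with ⟨e, he⟩ | ⟨e, he⟩
    · exact Or.inl ⟨(e, p - e), by ext <;> simp only <;> omega⟩
    · exact Or.inr ⟨(e, e - d), by ext <;> simp only <;> omega⟩

lemma constantCoeff_sqTheta {c : ℤ} (hc : 0 < c) {w : ℤ → ℤ} (hw : w 0 = 1) :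
    constantCoeff (sqTheta c w) = 1 := by
  have h : {x : ℤ | c * x ^ 2 = ((0 : ℕ) : ℤ)} = {0} := by
    ext x
    simp [hc.ne']
  rw [← coeff_zero_eq_constantCoeff_apply, sqTheta, coeff_thetaSeries, h, finsum_mem_singleton, hw]

lemma coeff_zero_oddTheta (w : ℤ → ℤ) : coeff 0 (oddTheta w) = 0 := by
  have h : {j : ℤ | (4 * j + 1) ^ 2 = ((0 : ℕ) : ℤ)} = ∅ := by
    ext x
    simp
    omega
  rw [oddTheta, coeff_thetaSeries, h, finsum_mem_empty]

lemma coeff_one_oddTheta (w : ℤ → ℤ) : coeff 1 (oddTheta w) = w 0 := by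
  have h : {j : ℤ | (4 * j + 1) ^ 2 = ((1 : ℕ) : ℤ)} = {0} := by
    ext x
    simp
    omega
  rw [oddTheta, coeff_thetaSeries, h, finsum_mem_singleton]

/-- A power series vanishing to first order is determined by its logarithmic derivative
and its leading coefficient. -/
lemma eq_of_logDeriv_eq {A B : ℤ⟦X⟧} (hA0 : coeff 0 A = 0) (hB0 : coeff 0 B = 0)
    (hA1 : coeff 1 A = 1) (hB1 : coeff 1 B = 1)
    (h : X * d⁄dX ℤ A * B = A * (X * d⁄dX ℤ B)) : A = B := by
  have hcoeff : ∀ (F : ℤ⟦X⟧) (n : ℕ), coeff n (X * d⁄dX ℤ F) = n * coeff n F := by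
    intro F n
    cases n with
    | zero => simp
    | succ n => rw [coeff_succ_X_mul, coeff_derivative]; push_cast; ring
  set G := A - B with hG
  have hGB : X * d⁄dX ℤ G * B = G * (X * d⁄dX ℤ B) := by
    rw [hG, map_sub]
    linear_combination h
  have hzero : ∀ n, coeff n G = 0 := by
    intro n
    induction n using Nat.strong_induction_on with
    | _ n ih =>
      rcases n with _ | _ | n
      · rw [hG, map_sub, hA0, hB0, sub_zero]
      · simp [hG, hA1, hB1]
      · have hc := congrArg (coeff (n + 2 + 1)) hGB
        rw [coeff_mul, coeff_mul, Finset.sum_eq_single (n + 2, 1), Finset.sum_eq_single (n + 2, 1),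
          hcoeff, hcoeff, hB1] at hc
        · push_cast at hc
          have : ((n : ℤ) + 1) * coeff (n + 2) G = 0 := by linear_combination hc
          exact (mul_eq_zero.mp this).resolve_left (by positivity)
        all_goals first
          | (intro hmem; simp at hmem)
          | (rintro ⟨i, j⟩ hmem hne
             rw [Finset.HasAntidiagonal.mem_antidiagonal] at hmem
             simp only [ne_eq, Prod.mk.injEq] at hmem hne
             simp only [hcoeff]
             rcases Nat.lt_or_ge i (n + 2) with hi | hi
             · rw [ih i hi]; ring
             · obtain rfl : j = 0 := by omega
               rw [hB0]; ring)
  exact sub_eq_zero.mp (PowerSeries.ext fun n => by rw [hzero n, map_zero])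

/-- Jacobi's identity `∑ (-1)ʲ (4j + 1) q^((4j + 1)²)` as a product of three theta series. -/
lemma oddTheta_eq_mul_sq :
    (oddTheta fun j => j.negOnePow * (4 * j + 1)) =
      (oddTheta fun j => j.negOnePow) * (sqTheta 8 1) ^ 2 := by
  have hab := two_mul_oddTheta_mul_sign
  have hw := oddTheta_wronskian
  have hF0 : constantCoeff (sqTheta 8 1) = 1 := constantCoeff_sqTheta (by norm_num) rfl
  set A := oddTheta fun j => j.negOnePow * (4 * j + 1) with hA
  set B := oddTheta fun j => j.negOnePow with hB
  set F := sqTheta 8 1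
  have hB0 : coeff 0 B = 0 := coeff_zero_oddTheta _
  have hB1 : coeff 1 B = 1 := by rw [hB, coeff_one_oddTheta]; simp
  have hF : coeff 0 (F ^ 2) = 1 := by simp [hF0]
  refine eq_of_logDeriv_eq (coeff_zero_oddTheta _) ?_ ?_ ?_ ?_
  · simp at hB0; simp [hB0]
  · rw [hA, coeff_one_oddTheta]; simp
  · rw [coeff_mul, Finset.sum_eq_single (1, 0), hB1, hF, one_mul]
    · rintro ⟨i, j⟩ hmem hne
      rw [Finset.HasAntidiagonal.mem_antidiagonal] at hmem
      simp only [ne_eq, Prod.mk.injEq] at hmem hne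
      obtain rfl : i = 0 := by omega
      simp only [hB0, zero_mul]
    · intro hmem; simp at hmem
  · rw [Derivation.leibniz, Derivation.leibniz_pow]
    simp only [smul_eq_mul, nsmul_eq_mul]
    push_cast
    linear_combination F ^ 2 * hw - F * (X * d⁄dX ℤ F) * hab

lemma theta_product_eq :
    oddTheta 1 * (sqTheta 16 fun x => x.negOnePow) * sqTheta 8 1 =
      oddTheta fun j => j.negOnePow * (4 * j + 1) := by
  have hp := two_mul_oddTheta_one_sq
  have hb := two_mul_oddTheta_sign_sq
  have hh := sqTheta_sixteen_sq
  have hH0 : constantCoeff (sqTheta 16 fun x => (x.negOnePow : ℤ)) = 1 :=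
    constantCoeff_sqTheta (by norm_num) (by simp)
  have hF0 : constantCoeff (sqTheta 8 1) = 1 := constantCoeff_sqTheta (by norm_num) rfl
  rw [oddTheta_eq_mul_sq]
  set P := oddTheta 1 with hP
  set B := oddTheta fun j => j.negOnePow with hB
  set F := sqTheta 8 1
  set M := sqTheta 8 fun x => x.negOnePow
  set H := sqTheta 16 fun x => x.negOnePow
  have hsq : (P * H) ^ 2 = (B * F) ^ 2 := by
    have h0 : (2 : ℤ⟦X⟧) ≠ 0 := by norm_num
    apply mul_left_cancel₀ h0
    linear_combination H ^ 2 * hp - F ^ 2 * hb + doubleOddTheta 1 * F * hh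
  have hcoeff : ∀ (O E : ℤ⟦X⟧), coeff 0 O = 0 → coeff 1 O = 1 → constantCoeff E = 1 →
      coeff 1 (O * E) = 1 := by
    intro O E h0 h1 hE
    rw [coeff_mul, Finset.sum_eq_single (1, 0), h1, coeff_zero_eq_constantCoeff_apply, hE, one_mul]
    · rintro ⟨i, j⟩ hmem hne
      rw [Finset.HasAntidiagonal.mem_antidiagonal] at hmem
      simp only [ne_eq, Prod.mk.injEq] at hmem hne
      obtain rfl : i = 0 := by omega
      simp only [h0, zero_mul]
    · intro hmem; simp at hmem
  rcases sq_eq_sq_iff_eq_or_eq_neg.mp hsq with h | h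
  · rw [h]; ring
  · have h1 := congrArg (coeff 1) h
    rw [map_neg, hcoeff P H (coeff_zero_oddTheta _) (by rw [hP, coeff_one_oddTheta]; rfl) hH0,
      hcoeff B F (coeff_zero_oddTheta _) (by rw [hB, coeff_one_oddTheta]; simp) hF0] at h1
    norm_num at h1

end ThetaIdentities

section Counting

/-- The number of integer triples satisfying a predicate. -/
noncomputable def tripleCount (P : ℤ → ℤ → ℤ → Prop) : ℕ :=
  {v : ℤ × ℤ × ℤ | P v.1 v.2.1 v.2.2}.ncard

/-- The number of representations of `k` by the diagonal form `a x² + b y² + c z²`. -/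
noncomputable def formCount (a b c k : ℤ) : ℕ :=
  tripleCount fun x y z => a * x ^ 2 + b * y ^ 2 + c * z ^ 2 = k

variable {P Q : ℤ → ℤ → ℤ → Prop}

lemma tripleCount_eq_of_map (f : ℤ → ℤ → ℤ → ℤ × ℤ × ℤ)
    (hinj : ∀ x y z x' y' z', f x y z = f x' y' z' → x = x' ∧ y = y' ∧ z = z')
    (hmap : ∀ x y z, P x y z → Q (f x y z).1 (f x y z).2.1 (f x y z).2.2)
    (hsurj : ∀ x y z, Q x y z → ∃ x' y' z', P x' y' z' ∧ f x' y' z' = (x, y, z)) :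
    tripleCount P = tripleCount Q := by
  refine Set.ncard_congr (fun v _ => f v.1 v.2.1 v.2.2) (fun v hv => hmap _ _ _ hv) ?_ ?_
  · rintro ⟨x, y, z⟩ ⟨x', y', z'⟩ - - h
    obtain ⟨rfl, rfl, rfl⟩ := hinj _ _ _ _ _ _ h
    rfl
  · rintro ⟨x, y, z⟩ h
    obtain ⟨x', y', z', hP, hf⟩ := hsurj x y z h
    exact ⟨(x', y', z'), hP, hf⟩

lemma tripleCount_eq_zero (h : ∀ x y z, ¬ P x y z) : tripleCount P = 0 := by
  simp [tripleCount, h]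

lemma tripleCount_split (hfin : {v : ℤ × ℤ × ℤ | P v.1 v.2.1 v.2.2}.Finite)
    (R : ℤ → ℤ → ℤ → Prop) :
    tripleCount P = (tripleCount fun x y z => P x y z ∧ R x y z) +
      tripleCount fun x y z => P x y z ∧ ¬ R x y z := by
  unfold tripleCount
  rw [← Set.ncard_union_eq ?_ (hfin.subset fun v hv => hv.1) (hfin.subset fun v hv => hv.1)]
  · congr 1
    ext v
    by_cases h : R v.1 v.2.1 v.2.2 <;> simp [h]
  · rw [Set.disjoint_left]
    rintro v ⟨-, h⟩ ⟨-, h'⟩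
    exact h' h

lemma finite_formSet {a b c : ℤ} (ha : 0 < a) (hb : 0 < b) (hc : 0 < c) (k : ℤ) :
    {v : ℤ × ℤ × ℤ | a * v.1 ^ 2 + b * v.2.1 ^ 2 + c * v.2.2 ^ 2 = k}.Finite := by
  refine (((properDegree_mul_sq ha).add
    ((properDegree_mul_sq hb).add (properDegree_mul_sq hc))).finite_fiber k).subset fun v hv => ?_
  simp only [Set.mem_ofPred_eq] at hv ⊢
  linarith

lemma sq_mod_cases (x : ℤ) :
    (x % 2 = 1 ∧ x ^ 2 % 8 = 1) ∨ (x % 4 = 0 ∧ x ^ 2 % 16 = 0) ∨ (x % 4 = 2 ∧ x ^ 2 % 16 = 4) := by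
  have h : ∃ a, x = 4 * a ∨ x = 4 * a + 1 ∨ x = 4 * a + 2 ∨ x = 4 * a + 3 := ⟨x / 4, by omega⟩
  obtain ⟨a, rfl | rfl | rfl | rfl⟩ := h <;> ring_nf <;> omega

lemma formCount_four_mul (m : ℤ) : formCount 1 8 64 (4 * m) = formCount 1 2 16 m := by
  symm
  refine tripleCount_eq_of_map (fun x y z => (2 * x, y, z)) ?_ ?_ ?_
  · grind
  · intro x y z h
    linear_combination 4 * h
  · intro x y z h
    obtain ⟨a, rfl⟩ : ∃ a, x = 2 * a := ⟨x / 2, by have := sq_mod_cases x; omega⟩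
    exact ⟨a, y, z, by linarith, rfl⟩

lemma formCount_two_mul (c m : ℤ) : formCount 1 2 (2 * c) (2 * m) = formCount 1 2 c m := by
  symm
  refine tripleCount_eq_of_map (fun x y z => (2 * y, x, z)) ?_ ?_ ?_
  · grind
  · intro x y z h
    linear_combination 2 * h
  · intro x y z h
    obtain ⟨a, rfl⟩ : ∃ a, x = 2 * a := by
      refine ⟨x / 2, ?_⟩
      have h1 := sq_mod_cases x
      have h2 : x ^ 2 = 2 * (m - y ^ 2 - c * z ^ 2) := by linear_combination h
      omega
    exact ⟨y, a, z, by linarith, rfl⟩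

lemma formCount_one_two_one (m : ℤ) : formCount 1 2 1 m = formCount 1 1 2 m := by
  refine tripleCount_eq_of_map (fun x y z => (x, z, y)) (by grind) ?_ ?_
  · intro x y z h
    linear_combination h
  · intro x y z h
    exact ⟨x, z, y, by linear_combination h, rfl⟩

lemma formCount_one_one_two_two_mul (m : ℤ) : formCount 1 1 2 (2 * m) = formCount 1 1 1 m := by
  symm
  refine tripleCount_eq_of_map (fun x y z => (x + y, x - y, z)) ?_ ?_ ?_
  · intro x y z x' y' z' h
    simp only [Prod.mk.injEq] at h
    omega
  · intro x y z h
    linear_combination 2 * h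
  · intro x y z h
    obtain ⟨a, ha⟩ : ∃ a, x = y + 2 * a :=
      ⟨(x - y) / 2, by have := sq_mod_cases x; have := sq_mod_cases y; omega⟩
    subst ha
    refine ⟨y + a, a, z, by linarith, ?_⟩
    ext <;> simp only <;> ring

lemma formCount_sum_sq_four_mul (m : ℤ) : formCount 1 1 1 (4 * m) = formCount 1 1 1 m := by
  symm
  refine tripleCount_eq_of_map (fun x y z => (2 * x, 2 * y, 2 * z)) (by grind) ?_ ?_
  · intro x y z h
    linear_combination 4 * h
  · intro x y z h
    have hx := sq_mod_cases x
    have hy := sq_mod_cases y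
    have hz := sq_mod_cases z
    obtain ⟨a, rfl⟩ : ∃ a, x = 2 * a := ⟨x / 2, by omega⟩
    obtain ⟨b, rfl⟩ : ∃ b, y = 2 * b := ⟨y / 2, by omega⟩
    obtain ⟨c, rfl⟩ : ∃ c, z = 2 * c := ⟨z / 2, by omega⟩
    exact ⟨a, b, c, by linarith, rfl⟩

/-- If exactly one coordinate of every representation as a sum of three squares has parity `e`,
that coordinate may be taken to be the first. -/
lemma formCount_sum_sq_eq_three_mul (m e : ℤ)
    (h : ∀ x y z : ℤ, x ^ 2 + y ^ 2 + z ^ 2 = m →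
      (x % 2 = e ∧ y % 2 ≠ e ∧ z % 2 ≠ e) ∨ (x % 2 ≠ e ∧ y % 2 = e ∧ z % 2 ≠ e) ∨
        (x % 2 ≠ e ∧ y % 2 ≠ e ∧ z % 2 = e)) :
    formCount 1 1 1 m = 3 * tripleCount fun x y z => x ^ 2 + y ^ 2 + z ^ 2 = m ∧ x % 2 = e := by
  have hfin : {v : ℤ × ℤ × ℤ | v.1 ^ 2 + v.2.1 ^ 2 + v.2.2 ^ 2 = m}.Finite := by
    simpa using finite_formSet one_pos one_pos one_pos m
  have h0 : formCount 1 1 1 m = tripleCount fun x y z => x ^ 2 + y ^ 2 + z ^ 2 = m := by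
    simp [formCount]
  rw [h0, tripleCount_split hfin fun x y z => x % 2 = e,
    tripleCount_split (P := fun x y z => x ^ 2 + y ^ 2 + z ^ 2 = m ∧ ¬ x % 2 = e)
      (hfin.subset fun v hv => hv.1) fun x y z => y % 2 = e]
  have hy : (tripleCount fun x y z => (x ^ 2 + y ^ 2 + z ^ 2 = m ∧ ¬ x % 2 = e) ∧ y % 2 = e) =
      tripleCount fun x y z => x ^ 2 + y ^ 2 + z ^ 2 = m ∧ x % 2 = e :=
    tripleCount_eq_of_map (fun x y z => (y, x, z)) (by grind) (by grind)
      fun x y z hv => ⟨y, x, z, by have := h x y z hv.1; grind, rfl⟩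
  have hz : (tripleCount fun x y z => (x ^ 2 + y ^ 2 + z ^ 2 = m ∧ ¬ x % 2 = e) ∧ ¬ y % 2 = e) =
      tripleCount fun x y z => x ^ 2 + y ^ 2 + z ^ 2 = m ∧ x % 2 = e :=
    tripleCount_eq_of_map (fun x y z => (z, y, x)) (by grind)
      (fun x y z hv => by have := h x y z hv.1.1; grind)
      fun x y z hv => ⟨z, y, x, by have := h x y z hv.1; grind, rfl⟩
  rw [hy, hz]
  ring

lemma formCount_sum_sq_two_mul_odd {m : ℤ} (hm : m % 2 = 1) :
    formCount 1 1 1 (2 * m) = 3 * formCount 1 1 2 m := by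
  rw [formCount_sum_sq_eq_three_mul _ 0 fun x y z h => by
    have hx := sq_mod_cases x
    have hy := sq_mod_cases y
    have hz := sq_mod_cases z
    omega]
  congr 1
  symm
  refine tripleCount_eq_of_map (fun x y z => (2 * z, x + y, x - y)) ?_ ?_ ?_
  · intro x y z x' y' z' h
    simp only [Prod.mk.injEq] at h
    omega
  · intro x y z h
    exact ⟨by linear_combination 2 * h, by simp⟩
  · rintro x y z ⟨h, hx⟩
    obtain ⟨c, rfl⟩ : ∃ c, x = 2 * c := ⟨x / 2, by omega⟩
    obtain ⟨a, ha⟩ : ∃ a, y = z + 2 * a :=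
      ⟨(y - z) / 2, by
        have := sq_mod_cases z
        have := sq_mod_cases y
        have := sq_mod_cases (2 * c)
        omega⟩
    subst ha
    refine ⟨z + a, a, c, by linarith, ?_⟩
    ext <;> simp only <;> ring

lemma formCount_one_one_two_odd {m : ℤ} (hm : m % 2 = 1) :
    formCount 1 1 2 m =
      2 * tripleCount fun x y z => 1 * x ^ 2 + 1 * y ^ 2 + 2 * z ^ 2 = m ∧ x % 2 = 1 := by
  rw [formCount, tripleCount_split (finite_formSet one_pos one_pos two_pos m)
    fun x y z => x % 2 = 1, two_mul]
  congr 1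
  have h : ∀ x y z : ℤ, 1 * x ^ 2 + 1 * y ^ 2 + 2 * z ^ 2 = m → (x % 2 = 1 ↔ ¬ y % 2 = 1) := by
    intro x y z h
    have hx := sq_mod_cases x
    have hy := sq_mod_cases y
    omega
  refine tripleCount_eq_of_map (fun x y z => (y, x, z)) (by grind) ?_ ?_
  · intro x y z hv
    have := h x y z hv.1
    grind
  · intro x y z hv
    refine ⟨y, x, z, ?_, rfl⟩
    have := h x y z hv.1
    grind

lemma formCount_one_one_two_eq_one_two_four {m : ℤ} (hm : m % 2 = 1) :
    formCount 1 1 2 m = 2 * formCount 1 2 4 m := by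
  rw [formCount_one_one_two_odd hm]
  congr 1
  symm
  refine tripleCount_eq_of_map (fun x y z => (x, 2 * z, y)) (by grind) ?_ ?_
  · intro x y z h
    have hx := sq_mod_cases x
    exact ⟨by linear_combination h, by simp only; omega⟩
  · rintro x y z ⟨h, hx⟩
    obtain ⟨c, rfl⟩ : ∃ c, y = 2 * c :=
      ⟨y / 2, by have := sq_mod_cases x; have := sq_mod_cases y; omega⟩
    exact ⟨x, z, c, by linear_combination h, rfl⟩

lemma formCount_one_one_two_eq_one_two_sixteen {m : ℤ} (hm : m % 8 = 1 ∨ m % 8 = 3) :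
    formCount 1 1 2 m = 2 * formCount 1 2 16 m := by
  rw [formCount_one_one_two_odd (by omega)]
  congr 1
  symm
  refine tripleCount_eq_of_map (fun x y z => (x, 4 * z, y)) (by grind) ?_ ?_
  · intro x y z h
    have hx := sq_mod_cases x
    exact ⟨by linear_combination h, by simp only; omega⟩
  · rintro x y z ⟨h, hx⟩
    obtain ⟨c, rfl⟩ : ∃ c, y = 4 * c :=
      ⟨y / 4, by
        have := sq_mod_cases x; have := sq_mod_cases y; have := sq_mod_cases z; omega⟩
    exact ⟨x, z, c, by linear_combination h, rfl⟩

lemma formCount_one_one_two_eq_one_eight_sixteen {m : ℤ} (hm : m % 8 = 1) :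
    formCount 1 1 2 m = 2 * formCount 1 8 16 m := by
  rw [formCount_one_one_two_odd (by omega)]
  congr 1
  symm
  refine tripleCount_eq_of_map (fun x y z => (x, 4 * z, 2 * y)) (by grind) ?_ ?_
  · intro x y z h
    have hx := sq_mod_cases x
    exact ⟨by linear_combination h, by simp only; omega⟩
  · rintro x y z ⟨h, hx⟩
    have h1 := sq_mod_cases x
    have h2 := sq_mod_cases y
    have h3 := sq_mod_cases z
    obtain ⟨c, rfl⟩ : ∃ c, y = 4 * c := ⟨y / 4, by omega⟩
    obtain ⟨d, rfl⟩ : ∃ d, z = 2 * d := ⟨z / 2, by omega⟩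
    exact ⟨x, d, c, by linear_combination h, rfl⟩

lemma formCount_sum_sq_eq_three_mul_one_two_two {m : ℤ} (hm : m % 4 = 1) :
    formCount 1 1 1 m = 3 * formCount 1 2 2 m := by
  rw [formCount_sum_sq_eq_three_mul _ 1 fun x y z h => by
    have hx := sq_mod_cases x
    have hy := sq_mod_cases y
    have hz := sq_mod_cases z
    omega]
  congr 1
  symm
  refine tripleCount_eq_of_map (fun x y z => (x, y + z, y - z)) ?_ ?_ ?_
  · intro x y z x' y' z' h
    simp only [Prod.mk.injEq] at h
    omega
  · intro x y z h
    have hx := sq_mod_cases x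
    exact ⟨by linear_combination h, by simp only; omega⟩
  · rintro x y z ⟨h, hx⟩
    obtain ⟨a, ha⟩ : ∃ a, y = z + 2 * a :=
      ⟨(y - z) / 2, by
        have := sq_mod_cases x; have := sq_mod_cases y; have := sq_mod_cases z; omega⟩
    subst ha
    refine ⟨x, z + a, a, by linarith, ?_⟩
    ext <;> simp only <;> ring

lemma formCount_one_two_two_of_one_mod_eight {m : ℤ} (hm : m % 8 = 1) :
    formCount 1 2 2 m = formCount 1 2 8 m := by
  symm
  refine tripleCount_eq_of_map (fun x y z => (x, y, 2 * z)) (by grind) ?_ ?_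
  · intro x y z h
    linear_combination h
  · intro x y z h
    obtain ⟨a, rfl⟩ : ∃ a, z = 2 * a :=
      ⟨z / 2, by
        have := sq_mod_cases x; have := sq_mod_cases y; have := sq_mod_cases z; omega⟩
    exact ⟨x, y, a, by linear_combination h, rfl⟩

lemma formCount_sum_sq_of_three_mod_eight {m : ℤ} (hm : m % 8 = 3) :
    formCount 1 1 1 m = formCount 1 2 2 m := by
  symm
  refine tripleCount_eq_of_map (fun x y z => (x, y + z, y - z)) ?_ ?_ ?_
  · intro x y z x' y' z' h
    simp only [Prod.mk.injEq] at h
    omega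
  · intro x y z h
    linear_combination h
  · intro x y z h
    obtain ⟨a, ha⟩ : ∃ a, y = z + 2 * a :=
      ⟨(y - z) / 2, by
        have := sq_mod_cases x; have := sq_mod_cases y; have := sq_mod_cases z; omega⟩
    subst ha
    refine ⟨x, z + a, a, by linarith, ?_⟩
    ext <;> simp only <;> ring

lemma formCount_one_two_two_of_three_mod_eight {m : ℤ} (hm : m % 8 = 3) :
    formCount 1 2 2 m = 2 * formCount 1 2 8 m := by
  have h : ∀ x y z : ℤ, 1 * x ^ 2 + 2 * y ^ 2 + 2 * z ^ 2 = m → (z % 2 = 0 ↔ ¬ y % 2 = 0) := by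
    intro x y z h
    have hx := sq_mod_cases x
    have hy := sq_mod_cases y
    have hz := sq_mod_cases z
    omega
  have h0 : (tripleCount fun x y z => 1 * x ^ 2 + 2 * y ^ 2 + 2 * z ^ 2 = m ∧ z % 2 = 0) =
      formCount 1 2 8 m := by
    symm
    refine tripleCount_eq_of_map (fun x y z => (x, y, 2 * z)) (by grind) ?_ ?_
    · intro x y z h
      exact ⟨by linear_combination h, by simp⟩
    · rintro x y z ⟨h, hz⟩
      obtain ⟨a, rfl⟩ : ∃ a, z = 2 * a := ⟨z / 2, by omega⟩
      exact ⟨x, y, a, by linear_combination h, rfl⟩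
  rw [← h0, formCount, tripleCount_split (finite_formSet one_pos two_pos two_pos m)
    fun x y z => z % 2 = 0, two_mul]
  congr 1
  refine tripleCount_eq_of_map (fun x y z => (x, z, y)) (by grind) ?_ ?_
  · intro x y z hv
    have := h x y z hv.1
    grind
  · intro x y z hv
    refine ⟨x, z, y, ?_, rfl⟩
    have := h x y z hv.1
    grind

lemma formCount_eq_two_mul_odd {b c m : ℤ} (hb : 0 < b) (hc : 0 < c) (hb2 : b % 2 = 0)
    (hc2 : c % 2 = 0) (hm : m % 2 = 1) :
    formCount 1 b c m =
      2 * tripleCount fun j y z => (4 * j + 1) ^ 2 + b * y ^ 2 + c * z ^ 2 = m := by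
  have hodd : ∀ x y z : ℤ, 1 * x ^ 2 + b * y ^ 2 + c * z ^ 2 = m → x % 2 = 1 := by
    intro x y z h
    obtain ⟨b, rfl⟩ : ∃ b', b = 2 * b' := ⟨b / 2, by omega⟩
    obtain ⟨c, rfl⟩ : ∃ c', c = 2 * c' := ⟨c / 2, by omega⟩
    have hx := sq_mod_cases x
    have h2 : x ^ 2 = m - 2 * (b * y ^ 2 + c * z ^ 2) := by linear_combination h
    omega
  rw [formCount, tripleCount_split (finite_formSet one_pos hb hc m) fun x y z => x % 4 = 1,
    two_mul]
  congr 1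
  · symm
    refine tripleCount_eq_of_map (fun j y z => (4 * j + 1, y, z)) (by grind) ?_ ?_
    · intro x y z h
      exact ⟨by linear_combination h, by simp only; omega⟩
    · rintro x y z ⟨h, hx⟩
      obtain ⟨j, rfl⟩ : ∃ j, x = 4 * j + 1 := ⟨x / 4, by omega⟩
      exact ⟨j, y, z, by linear_combination h, rfl⟩
  · symm
    refine tripleCount_eq_of_map (fun j y z => (-(4 * j + 1), y, z)) (by grind) ?_ ?_
    · intro x y z h
      exact ⟨by linear_combination h, by simp only; omega⟩
    · rintro x y z ⟨h, hx⟩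
      have := hodd x y z h
      obtain ⟨j, rfl⟩ : ∃ j, x = -(4 * j + 1) := ⟨(-x - 1) / 4, by omega⟩
      exact ⟨j, y, z, by linear_combination h, rfl⟩

end Counting

section Main

lemma formCount_eq_card (a b c : ℤ) (k : ℕ) :
    formCount a b c k =
      Nat.card {v : ℤ × ℤ × ℤ // a * v.1 ^ 2 + b * v.2.1 ^ 2 + c * v.2.2 ^ 2 = (k : ℤ)} :=
  rfl

lemma r2_eq_formCount (k : ℕ) : r2 k = formCount 1 1 2 k := by
  simp [r2, formCount_eq_card]

lemma finsum_negOnePow {ι : Type*} {s : Set ι} (hs : s.Finite) (z : ι → ℤ) :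
    ∑ᶠ i ∈ s, ((z i).negOnePow : ℤ) = 2 * ({i | i ∈ s ∧ z i % 2 = 0}.ncard : ℤ) - s.ncard := by
  classical
  have h : ∀ i, ((z i).negOnePow : ℤ) = 2 * (if z i % 2 = 0 then 1 else 0) - 1 := by
    intro i
    split_ifs with h
    · rw [Int.negOnePow_even _ (Int.even_iff.mpr h)]; rfl
    · rw [Int.negOnePow_odd _ (Int.odd_iff.mpr (by omega))]; rfl
  have hset : {i | i ∈ s ∧ z i % 2 = 0} = (hs.toFinset.filter fun i => z i % 2 = 0 : Finset ι) := by
    ext; simp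
  rw [finsum_mem_eq_finite_toFinset_sum _ hs, Finset.sum_congr rfl fun i _ => h i,
    Finset.sum_sub_distrib, ← Finset.mul_sum, Finset.sum_boole, hset, Set.ncard_coe_finset,
    Set.ncard_eq_toFinset_card _ hs]
  simp

/-- The coefficients of Jacobi's series `∑ (-1)ʲ (4j + 1) q^((4j + 1)²)`. -/
lemma finsum_negOnePow_mul_eq_sqTerm2 (k : ℕ) (hk : k % 8 = 1) :
    ((∑ᶠ j ∈ {j : ℤ | (4 * j + 1) ^ 2 = (k : ℤ)}, (j.negOnePow : ℤ) * (4 * j + 1) : ℤ) : ℚ) =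
      sqTerm2 k := by
  have hpow : ∀ n : ℕ, ((n : ℤ).negOnePow : ℤ) = (-1) ^ n := by
    intro n
    rw [Int.negOnePow_def, zpow_natCast]
    simp
  unfold sqTerm2
  split_ifs with hsq
  · obtain ⟨s, rfl⟩ := hsq
    rw [Nat.sqrt_eq]
    have hs : s % 4 = 1 ∨ s % 4 = 3 := by
      have : s % 4 = 0 ∨ s % 4 = 1 ∨ s % 4 = 2 ∨ s % 4 = 3 := by omega
      have h2 : s * s % 2 = 1 := by omega
      rw [Nat.mul_mod] at h2
      have : s % 2 = 0 ∨ s % 2 = 1 := by omega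
      rcases this with h | h
      · rw [h] at h2; omega
      · omega
    rcases hs with hs | hs
    · obtain ⟨i, rfl⟩ : ∃ i, s = 4 * i + 1 := ⟨s / 4, by omega⟩
      have hset : {j : ℤ | (4 * j + 1) ^ 2 = (((4 * i + 1) * (4 * i + 1) : ℕ) : ℤ)} =
          {(i : ℤ)} := by
        ext j
        push_cast
        rw [← sq]
        simp only [Set.mem_ofPred_eq, Set.mem_singleton_iff, sq_eq_sq_iff_eq_or_eq_neg]
        omega
      have h1 : (4 * i + 1 - 1) / 2 = 2 * i := by omega
      have h2 : ((4 * i + 1) * (4 * i + 1) - 1) / 8 = 2 * (i * i) + i := by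
        have : (4 * i + 1) * (4 * i + 1) = 8 * (2 * (i * i) + i) + 1 := by ring
        omega
      rw [hset, finsum_mem_singleton, hpow, h1, h2, pow_add, pow_mul, pow_mul]
      push_cast
      norm_num
    · obtain ⟨i, rfl⟩ : ∃ i, s = 4 * i + 3 := ⟨s / 4, by omega⟩
      have hset : {j : ℤ | (4 * j + 1) ^ 2 = (((4 * i + 3) * (4 * i + 3) : ℕ) : ℤ)} =
          {-((i + 1 : ℕ) : ℤ)} := by
        ext j
        push_cast
        rw [← sq]
        simp only [Set.mem_ofPred_eq, Set.mem_singleton_iff, sq_eq_sq_iff_eq_or_eq_neg]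
        omega
      have h1 : (4 * i + 3 - 1) / 2 = 2 * i + 1 := by omega
      have h2 : ((4 * i + 3) * (4 * i + 3) - 1) / 8 = 2 * (i * i + i) + (i + 1) := by
        have : (4 * i + 3) * (4 * i + 3) = 8 * (2 * (i * i + i) + (i + 1)) + 1 := by ring
        omega
      rw [hset, finsum_mem_singleton, Int.negOnePow_neg, hpow, h1, h2, pow_add _ (2 * i) 1,
        pow_add _ (2 * (i * i + i)), pow_mul, pow_mul]
      push_cast
      norm_num
      ring
  · have hset : {j : ℤ | (4 * j + 1) ^ 2 = (k : ℤ)} = ∅ := by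
      ext j
      simp only [Set.mem_ofPred_eq, Set.mem_empty_iff_false, iff_false]
      intro h
      exact hsq ⟨(4 * j + 1).natAbs, by zify; rw [← sq, sq_abs, h]⟩
    rw [hset, finsum_mem_empty, Int.cast_zero]

lemma formCount_one_eight_sixtyFour {k : ℕ} (hk : k % 8 = 1) :
    (formCount 1 8 64 k : ℚ) = 1 / 4 * formCount 1 1 2 k + sqTerm2 k := by
  have h8 : ProperDegree fun x : ℤ => 8 * x ^ 2 := properDegree_mul_sq (by norm_num)
  have h16 : ProperDegree fun x : ℤ => 16 * x ^ 2 := properDegree_mul_sq (by norm_num)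
  have hP := properDegree_odd.add (h8.add h16)
  have hmul : oddTheta 1 * (sqTheta 8 1 * sqTheta 16 fun x => x.negOnePow) =
      thetaSeries (fun i : ℤ × ℤ × ℤ => (4 * i.1 + 1) ^ 2 + (8 * i.2.1 ^ 2 + 16 * i.2.2 ^ 2))
        fun i => (1 : ℤ → ℤ) i.1 * ((1 : ℤ → ℤ) i.2.1 * (i.2.2.negOnePow : ℤ)) := by
    rw [sqTheta, sqTheta, thetaSeries_mul h8 h16, oddTheta,
      thetaSeries_mul properDegree_odd (h8.add h16)]
  have hcoeff := congrArg (coeff k)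
    ((show oddTheta 1 * (sqTheta 8 1 * sqTheta 16 fun x => x.negOnePow) =
      oddTheta 1 * (sqTheta 16 fun x => x.negOnePow) * sqTheta 8 1 by ring).trans theta_product_eq)
  rw [hmul, coeff_thetaSeries, oddTheta, coeff_thetaSeries] at hcoeff
  simp only [Pi.one_apply, one_mul] at hcoeff
  rw [finsum_negOnePow (hP.finite_fiber k) fun i : ℤ × ℤ × ℤ => i.2.2] at hcoeff
  have hall : ({i : ℤ × ℤ × ℤ |
      (4 * i.1 + 1) ^ 2 + (8 * i.2.1 ^ 2 + 16 * i.2.2 ^ 2) = (k : ℤ)}).ncard =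
      tripleCount fun j y z => (4 * j + 1) ^ 2 + 8 * y ^ 2 + 16 * z ^ 2 = (k : ℤ) := by
    simp only [tripleCount, add_assoc]
  have heven : ({i : ℤ × ℤ × ℤ | i ∈ {i : ℤ × ℤ × ℤ |
      (4 * i.1 + 1) ^ 2 + (8 * i.2.1 ^ 2 + 16 * i.2.2 ^ 2) = (k : ℤ)} ∧ i.2.2 % 2 = 0}).ncard =
      tripleCount fun j y z => (4 * j + 1) ^ 2 + 8 * y ^ 2 + 64 * z ^ 2 = (k : ℤ) := by
    symm
    refine (tripleCount_eq_of_map (Q := fun j y z =>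
      (4 * j + 1) ^ 2 + (8 * y ^ 2 + 16 * z ^ 2) = (k : ℤ) ∧ z % 2 = 0)
      (fun x y z => (x, y, 2 * z)) (by grind) ?_ ?_).trans rfl
    · intro x y z h
      exact ⟨by linear_combination h, by simp⟩
    · rintro x y z ⟨h, hz⟩
      obtain ⟨a, rfl⟩ : ∃ a, z = 2 * a := ⟨z / 2, by omega⟩
      exact ⟨x, y, a, by linear_combination h, rfl⟩
  rw [hall, heven] at hcoeff
  rw [formCount_one_one_two_eq_one_eight_sixteen (by omega),
    formCount_eq_two_mul_odd (by norm_num) (by norm_num) (by norm_num) (by norm_num) (by omega),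
    formCount_eq_two_mul_odd (by norm_num) (by norm_num) (by norm_num) (by norm_num) (by omega),
    ← finsum_negOnePow_mul_eq_sqTerm2 k hk, ← hcoeff]
  push_cast
  ring

lemma formCount_eight_mul (m : ℤ) : formCount 1 8 64 (8 * m) = formCount 1 2 8 m := by
  rw [show 8 * m = 4 * (2 * m) by ring, formCount_four_mul]
  exact formCount_two_mul 8 m

lemma formCount_sixteen_mul (m : ℤ) : formCount 1 8 64 (16 * m) = formCount 1 2 4 m := by
  rw [show 16 * m = 8 * (2 * m) by ring, formCount_eight_mul]
  exact formCount_two_mul 4 m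

lemma formCount_thirtyTwo_mul (m : ℤ) : formCount 1 8 64 (32 * m) = formCount 1 2 2 m := by
  rw [show 32 * m = 16 * (2 * m) by ring, formCount_sixteen_mul]
  exact formCount_two_mul 2 m

lemma formCount_sixtyFour_mul (m : ℤ) : formCount 1 8 64 (64 * m) = formCount 1 1 2 m := by
  rw [show 64 * m = 32 * (2 * m) by ring, formCount_thirtyTwo_mul, ← formCount_one_two_one]
  exact formCount_two_mul 1 m

lemma formCount_one_one_two_eight_mul (m : ℤ) : formCount 1 1 2 (8 * m) = formCount 1 1 1 m := by
  rw [show 8 * m = 2 * (4 * m) by ring, formCount_one_one_two_two_mul, formCount_sum_sq_four_mul]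

lemma formCount_one_one_two_thirtyTwo_mul (m : ℤ) :
    formCount 1 1 2 (32 * m) = formCount 1 1 1 m := by
  rw [show 32 * m = 8 * (4 * m) by ring, formCount_one_one_two_eight_mul, formCount_sum_sq_four_mul]

lemma formCount_eq_zero {a b c k : ℤ}
    (h : ∀ x y z : ℤ, a * x ^ 2 + b * y ^ 2 + c * z ^ 2 ≠ k) : formCount a b c k = 0 :=
  tripleCount_eq_zero h

end Main

theorem stmt_2 (a t α : ℕ) (hα : α = 1 ∨ α = 3 ∨ α = 5 ∨ α = 7)
    (k : ℕ) (hk : k = 2 ^ a * (8 * t + α)) :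
    (Nat.card {v : ℤ × ℤ × ℤ // v.1 ^ 2 + 8 * v.2.1 ^ 2 + 64 * v.2.2 ^ 2 = (k : ℤ)} : ℚ) =
      if a = 0 ∧ α = 1 then (1 / 4 : ℚ) * r2 k + sqTerm2 k
      else if (a = 2 ∧ α = 1) ∨ (a = 2 ∧ α = 3) ∨ a = 4 then (1 / 6 : ℚ) * r2 k
      else if (a = 3 ∧ α = 1) ∨ (a = 5 ∧ α = 1) ∨ (a = 5 ∧ α = 5) ∨ a = 6 then
        (1 / 3 : ℚ) * r2 k
      else if a = 3 ∧ α = 3 then (1 / 2 : ℚ) * r2 k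
      else if (a = 5 ∧ α = 3) ∨ 7 ≤ a then (r2 k : ℚ)
      else 0 := by
  have hN : Nat.card {v : ℤ × ℤ × ℤ // v.1 ^ 2 + 8 * v.2.1 ^ 2 + 64 * v.2.2 ^ 2 = (k : ℤ)} =
      formCount 1 8 64 k := by
    simp [formCount_eq_card]
  rw [hN, r2_eq_formCount]
  obtain ⟨m, hm⟩ : ∃ m : ℤ, m = 8 * t + α := ⟨_, rfl⟩
  have hmodd : m % 2 = 1 := by omega
  have hkm : (k : ℤ) = 2 ^ a * m := by rw [hk, hm]; push_cast; ring
  obtain rfl | rfl | rfl | rfl | rfl | rfl | rfl | ⟨n, rfl⟩ :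
      a = 0 ∨ a = 1 ∨ a = 2 ∨ a = 3 ∨ a = 4 ∨ a = 5 ∨ a = 6 ∨ ∃ n, a = n + 7 := by
    by_cases h : 7 ≤ a
    · exact Or.inr (Or.inr (Or.inr (Or.inr (Or.inr (Or.inr (Or.inr ⟨a - 7, by omega⟩))))))
    · omega
  · by_cases h1 : α = 1
    · simpa [h1] using formCount_one_eight_sixtyFour (k := k) (by omega)
    · have h0 : formCount 1 8 64 k = 0 := formCount_eq_zero fun x y z h => by
        have := sq_mod_cases x
        omega
      simp [h0, h1]
  · have h0 : formCount 1 8 64 k = 0 := formCount_eq_zero fun x y z h => by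
      have := sq_mod_cases x
      omega
    simp [h0]
  · rw [show (k : ℤ) = 4 * m by rw [hkm]; ring, formCount_four_mul]
    by_cases h13 : α = 1 ∨ α = 3
    · rw [show 4 * m = 2 * (2 * m) by ring, formCount_one_one_two_two_mul,
        formCount_sum_sq_two_mul_odd hmodd,
        formCount_one_one_two_eq_one_two_sixteen (by omega)]
      rcases h13 with h | h <;> simp [h] <;> ring
    · have h0 : formCount 1 2 16 m = 0 := formCount_eq_zero fun x y z h => by
        have := sq_mod_cases x
        have := sq_mod_cases y
        omega
      simp [h0]
      omega
  · rw [show (k : ℤ) = 8 * m by rw [hkm]; ring, formCount_eight_mul,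
      formCount_one_one_two_eight_mul]
    rcases hα with h | h | h | h
    · rw [formCount_sum_sq_eq_three_mul_one_two_two (by omega),
        formCount_one_two_two_of_one_mod_eight (by omega)]
      simp [h]
    · rw [formCount_sum_sq_of_three_mod_eight (by omega),
        formCount_one_two_two_of_three_mod_eight (by omega)]
      simp [h]
    all_goals
      have h0 : formCount 1 2 8 m = 0 := formCount_eq_zero fun x y z h => by
        have := sq_mod_cases x
        have := sq_mod_cases y
        omega
      simp [h0, h]
  · rw [show (k : ℤ) = 8 * (2 * m) by rw [hkm]; ring, formCount_one_one_two_eight_mul,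
      show 8 * (2 * m) = 16 * m by ring, formCount_sixteen_mul,
      formCount_sum_sq_two_mul_odd hmodd, formCount_one_one_two_eq_one_two_four hmodd]
    simp
    ring
  · rw [show (k : ℤ) = 32 * m by rw [hkm]; ring, formCount_thirtyTwo_mul,
      formCount_one_one_two_thirtyTwo_mul]
    rcases hα with h | h | h | h
    · rw [formCount_sum_sq_eq_three_mul_one_two_two (by omega)]
      simp [h]
    · rw [formCount_sum_sq_of_three_mod_eight (by omega)]
      simp [h]
    · rw [formCount_sum_sq_eq_three_mul_one_two_two (by omega)]
      simp [h]
    · have h0 : formCount 1 2 2 m = 0 := formCount_eq_zero fun x y z h => by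
        have := sq_mod_cases x
        have := sq_mod_cases y
        have := sq_mod_cases z
        omega
      simp [h0, h]
  · rw [show (k : ℤ) = 32 * (2 * m) by rw [hkm]; ring, formCount_one_one_two_thirtyTwo_mul,
      show 32 * (2 * m) = 64 * m by ring, formCount_sixtyFour_mul,
      formCount_sum_sq_two_mul_odd hmodd]
    simp
  · rw [show (k : ℤ) = 32 * (4 * (2 ^ n * m)) by rw [hkm]; ring,
      formCount_one_one_two_thirtyTwo_mul, formCount_sum_sq_four_mul,
      show 32 * (4 * (2 ^ n * m)) = 64 * (2 * (2 ^ n * m)) by ring, formCount_sixtyFour_mul,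
      formCount_one_one_two_two_mul]
    simp
end
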